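/- Let $t \ge 4.5$ be a real number and let $G$ be a $t$-tough $(P_4 \cup P_1)$-free graph on $n \ge 3$ vertices, and let $S$ be a cutset of $G$. If $G-S$ has a component of order at least $\frac{2n}{t+1}$ and the total number of vertices in the remaining components of $G-S$ is at least $\frac{2n}{t+1}$, then $G$ is Hamiltonian. -/

import Mathlib

open SimpleGraph

/-- The number of connected components of `G - S`. -/
noncomputable def ncomps {V : Type*} (G : SimpleGraph V) (S : Set V) : ℕ :=
  Nat.card (G.induce Sᶜ).ConnectedComponent

/-- The graph `P₄ ∪ P₁`: a path on four vertices plus an isolated vertex. -/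
def P4P1 : SimpleGraph (Fin 5) :=
  SimpleGraph.fromEdgeSet {s((0 : Fin 5), (1 : Fin 5)), s((1 : Fin 5), (2 : Fin 5)),
    s((2 : Fin 5), (3 : Fin 5))}

/-- `G` has no induced subgraph isomorphic to `P₄ ∪ P₁`. -/
def P4P1Free {V : Type*} (G : SimpleGraph V) : Prop := IsEmpty (P4P1 ↪g G)

/-- `G` has no induced subgraph isomorphic to `P₄`. -/
def P4Free {V : Type*} (G : SimpleGraph V) : Prop := IsEmpty (SimpleGraph.pathGraph 4 ↪g G)

/-- `G` is `t`-tough. -/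
def Tough {V : Type*} (t : ℝ) (G : SimpleGraph V) : Prop :=
  ∀ S : Set V, 2 ≤ ncomps G S → t * (ncomps G S : ℝ) ≤ (S.ncard : ℝ)

/-- `S` is a cutset of `G`, i.e. `G - S` is disconnected. -/
def IsCutset {V : Type*} (G : SimpleGraph V) (S : Set V) : Prop :=
  2 ≤ ncomps G S

/-- `S` is a scattering set of `G`. -/
def IsScatSet {V : Type*} (G : SimpleGraph V) (S : Set V) : Prop :=
  2 ≤ ncomps G S ∧ ∀ T : Set V, 2 ≤ ncomps G T →
    (ncomps G T : ℤ) - (T.ncard : ℤ) ≤ (ncomps G S : ℤ) - (S.ncard : ℤ)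

/-- `S` is a maximal scattering set of `G`. -/
def IsMaxScatSet {V : Type*} (G : SimpleGraph V) (S : Set V) : Prop :=
  IsScatSet G S ∧ ∀ T : Set V, IsScatSet G T → S ⊆ T → S = T

/-- `G` is `t`-tough with respect to `S`. -/
def ToughWrt {V : Type*} (t : ℝ) (G : SimpleGraph V) (S : Set V) : Prop :=
  ∀ W : Set V, 2 ≤ ncomps G W →
    (∀ c : (G.induce Sᶜ).ConnectedComponent,
      ∃ v : ↥Sᶜ, (G.induce Sᶜ).connectedComponentMk v = c ∧ (v : V) ∉ W) →
    t * (ncomps G W : ℝ) ≤ (W.ncard : ℝ)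

/-- `G` has no induced path on four vertices inside the vertex set `Y`. -/
def P4FreeOn {V : Type*} (G : SimpleGraph V) (Y : Set V) : Prop :=
  ∀ ⦃a b c d : V⦄, a ∈ Y → b ∈ Y → c ∈ Y → d ∈ Y → G.Adj a b → G.Adj b c → G.Adj c d →
    ¬ G.Adj a c → ¬ G.Adj b d → G.Adj a d

/-- `u` and `v` are equal, adjacent, or joined by a path of length two with middle vertex
in `Y`. -/
def Near {V : Type*} (G : SimpleGraph V) (Y : Set V) (u v : V) : Prop :=
  u = v ∨ G.Adj u v ∨ ∃ q ∈ Y, G.Adj u q ∧ G.Adj q v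

section P4Free

variable {V : Type*} {G : SimpleGraph V} {Y : Set V}

lemma P4FreeOn.mono {Z : Set V} (h : P4FreeOn G Y) (hZ : Z ⊆ Y) : P4FreeOn G Z :=
  fun _ _ _ _ ha hb hc hd => h (hZ ha) (hZ hb) (hZ hc) (hZ hd)

lemma P4FreeOn.compl (h : P4FreeOn G Y) : P4FreeOn Gᶜ Y := by
  intro a b c d ha hb hc hd hab hbc hcd hac hbd
  rcases eq_or_ne a c with rfl | nac
  · exact hcd
  rcases eq_or_ne b d with rfl | nbd
  · exact hab
  simp only [compl_adj] at *
  have hac' : G.Adj a c := by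
    by_contra hn
    exact hac ⟨nac, hn⟩
  have hbd' : G.Adj b d := by
    by_contra hn
    exact hbd ⟨nbd, hn⟩
  refine ⟨fun e => by subst e; exact hcd.2 hac'.symm, fun had => ?_⟩
  exact hbc.2 (h hb hd ha hc hbd' had.symm hac' (fun e => hab.2 e.symm) (fun e => hcd.2 e.symm))

lemma P4FreeOn.of_p4P1Free (h : P4P1Free G) {w : V} (hw : ∀ v ∈ Y, ¬ G.Adj v w) :
    P4FreeOn G Y := by
  intro a b c d ha hb hc hd hab hbc hcd hac hbd
  by_contra had
  have hwa := hw a ha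
  have hwb := hw b hb
  have hwc := hw c hc
  have hwd := hw d hd
  have key : ∀ x y, G.Adj (![a, b, c, d, w] x) (![a, b, c, d, w] y) ↔ P4P1.Adj x y := by
    intro x y
    fin_cases x <;> fin_cases y <;>
      simp [P4P1, hab, hbc, hcd, hac, hbd, had, hwa, hwb, hwc, hwd, hab.symm, hbc.symm,
        hcd.symm, G.adj_comm c a, G.adj_comm d b, G.adj_comm d a, G.adj_comm w]
  have hinj : Function.Injective ![a, b, c, d, w] := by
    have nac : a ≠ c := by rintro rfl; exact had hcd
    have nad : a ≠ d := by rintro rfl; exact hac hcd.symm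
    have nbd : b ≠ d := by rintro rfl; exact had hab
    have naw : a ≠ w := by rintro rfl; exact hwb hab.symm
    have nbw : b ≠ w := by rintro rfl; exact hwa hab
    have ncw : c ≠ w := by rintro rfl; exact hwb hbc
    have ndw : d ≠ w := by rintro rfl; exact hwc hcd
    intro x y hxy
    fin_cases x <;> fin_cases y <;>
      simp_all [hab.ne, hbc.ne, hcd.ne, hab.ne', hbc.ne', hcd.ne']
  exact h.false ⟨⟨_, hinj⟩, fun {x y} => key x y⟩

lemma Near.symm {u v : V} (h : Near G Y u v) : Near G Y v u := by
  rcases h with rfl | h | ⟨q, hq, h1, h2⟩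
  · exact Or.inl rfl
  · exact Or.inr (Or.inl h.symm)
  · exact Or.inr (Or.inr ⟨q, hq, h2.symm, h1.symm⟩)

lemma Near.adj (hY : P4FreeOn G Y) {u v w : V} (hu : u ∈ Y) (hv : v ∈ Y) (hw : w ∈ Y)
    (h : Near G Y u v) (hvw : G.Adj v w) : Near G Y u w := by
  rcases h with rfl | h | ⟨q, hq, h1, h2⟩
  · exact Or.inr (Or.inl hvw)
  · exact Or.inr (Or.inr ⟨v, hv, h, hvw⟩)
  · by_cases huv : G.Adj u v
    · exact Or.inr (Or.inr ⟨v, hv, huv, hvw⟩)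
    by_cases hqw : G.Adj q w
    · exact Or.inr (Or.inr ⟨q, hq, h1, hqw⟩)
    · exact Or.inr (Or.inl (hY hu hq hv hw h1 h2 hvw huv hqw))

lemma Near.trans (hY : P4FreeOn G Y) {u v w : V} (hu : u ∈ Y) (hv : v ∈ Y) (hw : w ∈ Y)
    (h : Near G Y u v) (hvw : Near G Y v w) : Near G Y u w := by
  rcases hvw with rfl | hvw | ⟨q, hq, h1, h2⟩
  · exact h
  · exact h.adj hY hu hv hw hvw
  · exact (h.adj hY hu hv hq h1).adj hY hu hq hw h2

/-- If `x` has a neighbour but also a non-neighbour in a class of `Near`, then some edge of that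
class has exactly one end adjacent to `x`. -/
lemma Near.exists_edge {x u v : V} (h : Near G Y u v) (hu : u ∈ Y) (hv : v ∈ Y)
    (hxu : G.Adj x u) (hxv : ¬ G.Adj x v) :
    ∃ d ∈ Y, ∃ d' ∈ Y, G.Adj d d' ∧ G.Adj x d ∧ ¬ G.Adj x d' ∧ Near G Y u d := by
  rcases h with rfl | h | ⟨q, hq, h1, h2⟩
  · exact absurd hxu hxv
  · exact ⟨u, hu, v, hv, h, hxu, hxv, Or.inl rfl⟩
  · by_cases hxq : G.Adj x q
    · exact ⟨q, hq, v, hv, h2, hxq, hxv, Or.inr (Or.inl h1)⟩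
    · exact ⟨u, hu, q, hq, h1, hxu, hxq, Or.inl rfl⟩

/-- The classes of `Near` inside a set without induced `P₄` can be labelled. -/
lemma P4FreeOn.exists_label (hY : P4FreeOn G Y) :
    ∃ κ : V → V, ∀ u ∈ Y, ∀ v ∈ Y, (κ u = κ v ↔ Near G Y u v) := by
  let s : Setoid V :=
    { r := fun u v => (u ∈ Y ∧ v ∈ Y ∧ Near G Y u v) ∨ u = v
      iseqv :=
        { refl := fun _ => Or.inr rfl
          symm := by
            rintro u v (⟨hu, hv, h⟩ | rfl)
            · exact Or.inl ⟨hv, hu, h.symm⟩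
            · exact Or.inr rfl
          trans := by
            rintro u v w (⟨hu, hv, h⟩ | rfl) (⟨_, hw, h'⟩ | rfl)
            · exact Or.inl ⟨hu, hw, h.trans hY hu hv hw h'⟩
            · exact Or.inl ⟨hu, hv, h⟩
            · exact Or.inl ⟨by assumption, hw, h'⟩
            · exact Or.inr rfl } }
  refine ⟨fun v => (Quotient.mk s v).out, fun u hu v hv => ?_⟩
  rw [Quotient.out_inj, Quotient.eq]
  constructor
  · rintro (⟨_, _, h⟩ | h)
    · exact h
    · exact Or.inl h
  · intro h
    exact Or.inl ⟨hu, hv, h⟩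

variable [DecidableEq V]

private lemma exists_split_insert_aux {Z : Finset V} {v : V} (hv : v ∉ Z)
    (hY : P4FreeOn G (insert v Z : Finset V)) {A B : Finset V} (hA : A.Nonempty)
    (hB : B.Nonempty) (hAB : Disjoint A B) (hZ : A ∪ B = Z)
    (hno : ∀ a ∈ A, ∀ b ∈ B, ¬ G.Adj a b) :
    ∃ A' B' : Finset V, A'.Nonempty ∧ B'.Nonempty ∧ Disjoint A' B' ∧ A' ∪ B' = insert v Z ∧
      ((∀ a ∈ A', ∀ b ∈ B', ¬ G.Adj a b) ∨ ∀ a ∈ A', ∀ b ∈ B', G.Adj a b) := by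
  classical
  by_cases hall : ∀ z ∈ Z, G.Adj v z
  · refine ⟨{v}, Z, by simp, ?_, by simpa using hv, rfl, Or.inr (by simpa using hall)⟩
    obtain ⟨a, ha⟩ := hA
    exact ⟨a, hZ ▸ Finset.mem_union_left _ ha⟩
  push Not at hall
  obtain ⟨z, hz, hvz⟩ := hall
  have hYZ : P4FreeOn G (Z : Set V) := hY.mono (by simp)
  set D := Z.filter (fun w => Near G (Z : Set V) z w) with hD
  have hDZ : D ⊆ Z := Finset.filter_subset _ _
  have hzD : z ∈ D := by simp [hD, hz, Near]
  have hDadj : ∀ d ∈ D, ∀ w ∈ Z, G.Adj d w → w ∈ D := by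
    intro d hd w hw hdw
    rw [hD, Finset.mem_filter] at hd ⊢
    exact ⟨hw, hd.2.adj hYZ hz hd.1 hw hdw⟩
  have hne : (Z \ D).Nonempty := by
    by_contra hcon
    have hZD : ∀ w ∈ Z, w ∈ D := by
      intro w hw
      by_contra hwD
      exact hcon ⟨w, by simp [hw, hwD]⟩
    have hside : ∀ w ∈ Z, Near G (Z : Set V) z w → (z ∈ A ↔ w ∈ A) := by
      have hstep : ∀ x ∈ Z, ∀ y ∈ Z, G.Adj x y → (x ∈ A ↔ y ∈ A) := by
        intro x hx y hy hxy
        rw [← hZ, Finset.mem_union] at hx hy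
        have h1 := hno x
        have h2 := hno y
        have h3 := hxy.symm
        grind
      rintro w hw (rfl | h | ⟨q, hq, h1, h2⟩)
      · rfl
      · exact hstep _ hz _ hw h
      · exact (hstep _ hz _ hq h1).trans (hstep _ hq _ hw h2)
    obtain ⟨a, ha⟩ := hA
    obtain ⟨b, hb⟩ := hB
    have haZ : a ∈ Z := hZ ▸ Finset.mem_union_left _ ha
    have hbZ : b ∈ Z := hZ ▸ Finset.mem_union_right _ hb
    have h1 := hside a haZ (Finset.mem_filter.1 (hZD a haZ)).2
    have h2 := hside b hbZ (Finset.mem_filter.1 (hZD b hbZ)).2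
    exact Finset.disjoint_left.1 hAB (h2.1 (h1.2 ha)) hb
  by_cases hvD : ∃ d ∈ D, G.Adj v d
  · obtain ⟨d, hd, hvd⟩ := hvD
    have hdz : Near G (Z : Set V) d z := (Finset.mem_filter.1 hd).2.symm
    obtain ⟨e, he, e', he', hee', hve, hve', hde⟩ :=
      hdz.exists_edge (hDZ hd) hz hvd hvz
    have heD : e ∈ D := by
      rw [hD, Finset.mem_filter]
      exact ⟨he, hdz.symm.trans hYZ hz (hDZ hd) he hde⟩
    have heD' := hDadj e heD e' he' hee'
    refine ⟨Z \ D, insert v D, hne, by simp, ?_, ?_, Or.inl ?_⟩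
    · rw [Finset.disjoint_left]; grind
    · ext x; grind
    · intro a ha b hb hab
      rw [Finset.mem_sdiff] at ha
      rw [Finset.mem_insert] at hb
      have hnot : ∀ d ∈ D, ¬ G.Adj a d := fun d hd had => ha.2 (hDadj d hd a ha.1 had.symm)
      rcases hb with rfl | hb
      · refine hnot e' heD' (hY (a := a) (b := b) (c := e) (d := e') ?_ ?_ ?_ ?_ hab hve hee'
          (hnot e heD) hve')
        · simp [ha.1]
        · simp
        · simp [hDZ heD]
        · simp [hDZ heD']
      · exact hnot b hb hab
  · push Not at hvD
    refine ⟨D, insert v (Z \ D), ⟨z, hzD⟩, by simp, ?_, ?_, Or.inl ?_⟩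
    · rw [Finset.disjoint_left]; grind
    · ext x; grind
    · intro a ha b hb hab
      rw [Finset.mem_insert, Finset.mem_sdiff] at hb
      rcases hb with rfl | hb
      · exact hvD a ha hab.symm
      · exact hb.2 (hDadj a ha b hb.1 hab)

/-- A finite set of at least two vertices without induced `P₄` splits into two nonempty parts
which are completely joined or have no edges between them. -/
lemma P4FreeOn.exists_split (Y : Finset V) (hY : P4FreeOn G (Y : Set V)) (h2 : 2 ≤ Y.card) :
    ∃ A B : Finset V, A.Nonempty ∧ B.Nonempty ∧ Disjoint A B ∧ A ∪ B = Y ∧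
      ((∀ a ∈ A, ∀ b ∈ B, ¬ G.Adj a b) ∨ ∀ a ∈ A, ∀ b ∈ B, G.Adj a b) := by
  induction Y using Finset.induction_on with
  | empty => simp at h2
  | insert v Z hv ih =>
    rw [Finset.card_insert_of_notMem hv] at h2
    rcases Nat.lt_or_ge Z.card 2 with hZ | hZ
    · obtain ⟨z, rfl⟩ := Finset.card_eq_one.1 (show Z.card = 1 by omega)
      refine ⟨{v}, {z}, by simp, by simp, by simpa using hv, rfl, ?_⟩
      by_cases h : G.Adj v z
      · right; simpa using h
      · left; simpa using h
    · obtain ⟨A, B, hA, hB, hAB, hU, h | h⟩ := ih (hY.mono (by simp)) hZ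
      · exact exists_split_insert_aux hv hY hA hB hAB hU h
      · obtain ⟨A', B', hA', hB', hAB', hU', h'⟩ :=
          exists_split_insert_aux (G := Gᶜ) hv hY.compl hA hB hAB hU
            (fun a ha b hb hab => hab.2 (h a ha b hb))
        refine ⟨A', B', hA', hB', hAB', hU', ?_⟩
        rcases h' with h' | h'
        · right
          intro a ha b hb
          by_contra hn
          exact h' a ha b hb ⟨fun e => Finset.disjoint_left.1 hAB' ha (e ▸ hb), hn⟩
        · left
          exact fun a ha b hb => (h' a ha b hb).2

end P4Free


/-- `P` is a list of nonempty paths of `G`. -/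
def PathSystem {V : Type*} (G : SimpleGraph V) (P : List (List V)) : Prop :=
  ∀ τ ∈ P, τ ≠ [] ∧ τ.IsChain G.Adj

/-- `Y` has a partition into paths whose number is at most the scattering number of the graph
induced on `Y`, as witnessed by the set `W` and the labelling `φ` of the components
outside `W`. -/
def HasPathCover {V : Type*} [DecidableEq V] (G : SimpleGraph V) (Y : Finset V) : Prop :=
  ∃ (P : List (List V)) (W : Finset V) (φ : V → V), PathSystem G P ∧ P.flatten.Nodup ∧
    (∀ v, v ∈ P.flatten ↔ v ∈ Y) ∧ W ⊆ Y ∧ (∀ v ∈ Y, v ∉ W → φ v ∈ Y) ∧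
    (∀ u ∈ Y, u ∉ W → ∀ v ∈ Y, v ∉ W → G.Adj u v → φ u = φ v) ∧
    W.card + P.length ≤ ((Y \ W).image φ).card

section PathCover

variable {V : Type*} {G : SimpleGraph V}

lemma PathSystem.tail {τ : List V} {P : List (List V)} (h : PathSystem G (τ :: P)) :
    PathSystem G P :=
  fun σ hσ => h σ (List.mem_cons_of_mem _ hσ)

lemma PathSystem.cons {τ : List V} {P : List (List V)} (h : PathSystem G P) (hne : τ ≠ [])
    (hτ : τ.IsChain G.Adj) : PathSystem G (τ :: P) := by
  intro σ hσ
  rcases List.mem_cons.1 hσ with rfl | hσ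
  · exact ⟨hne, hτ⟩
  · exact h σ hσ

lemma PathSystem.split_one {P : List (List V)} (hP : PathSystem G P)
    (h : P.length < P.flatten.length) :
    ∃ P' : List (List V), PathSystem G P' ∧ P'.flatten = P.flatten ∧
      P'.length = P.length + 1 := by
  induction P with
  | nil => simp at h
  | cons τ P ih =>
    obtain ⟨hne, hτ⟩ := hP τ (by simp)
    match τ, hne, hτ with
    | [x], _, _ =>
      obtain ⟨P', h1, h2, h3⟩ := ih hP.tail (by simp at h ⊢; omega)
      exact ⟨[x] :: P', h1.cons (by simp) (by simp), by simp [h2], by simp [h3]⟩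
    | x :: y :: τ, _, hτ =>
      exact ⟨[x] :: (y :: τ) :: P, (hP.tail.cons (by simp) (List.isChain_cons_cons.1 hτ).2).cons
        (by simp) (by simp), by simp, by simp⟩

lemma PathSystem.split {P : List (List V)} (hP : PathSystem G P) {k : ℕ}
    (h1 : P.length ≤ k) (h2 : k ≤ P.flatten.length) :
    ∃ P' : List (List V), PathSystem G P' ∧ P'.flatten = P.flatten ∧ P'.length = k := by
  induction k, h1 using Nat.le_induction with
  | base => exact ⟨P, hP, rfl, rfl⟩
  | succ k _ ih =>
    obtain ⟨P', h3, h4, h5⟩ := ih (by omega)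
    obtain ⟨P'', h6, h7, h8⟩ := h3.split_one (by rw [h4]; omega)
    exact ⟨P'', h6, h7.trans h4, by omega⟩

lemma PathSystem.interleave {s : List V} {P : List (List V)} (hP : PathSystem G P)
    (hs : s.length + 1 ≤ P.length) (hadj : ∀ x ∈ P.flatten, ∀ y ∈ s, G.Adj x y) :
    ∃ P' : List (List V), PathSystem G P' ∧ P'.flatten.Perm (P.flatten ++ s) ∧
      P'.length + s.length = P.length ∧ ∀ τ ∈ P', ∀ x ∈ τ.head?, x ∈ P.flatten := by
  induction s generalizing P with
  | nil =>
    refine ⟨P, hP, by simp, by simp, fun τ hτ x hx => ?_⟩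
    exact List.mem_flatten.2 ⟨τ, hτ, List.mem_of_mem_head? hx⟩
  | cons c s ih =>
    match P, hP, hs, hadj with
    | [], _, hs, _ => simp at hs
    | τ₁ :: P, hP, hs, hadj =>
      obtain ⟨P', h1, h2, h3, h4⟩ := ih hP.tail (by simpa using hs)
        (fun x hx y hy => hadj x (by simp [hx]) y (by simp [hy]))
      match P', h1, h2, h3, h4 with
      | [], _, _, h3, _ => simp at h3 hs; omega
      | τ :: P', h1, h2, h3, h4 =>
        obtain ⟨hne₁, hτ₁⟩ := hP τ₁ (by simp)
        obtain ⟨hne, hτ⟩ := h1 τ (by simp)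
        refine ⟨(τ₁ ++ c :: τ) :: P', h1.tail.cons (by simp) ?_, ?_, ?_, ?_⟩
        · rw [List.isChain_append, List.isChain_cons]
          refine ⟨hτ₁, ⟨fun y hy => ?_, hτ⟩, fun x hx y hy => ?_⟩
          · have := h4 τ (by simp) y hy
            exact (hadj y (by simp only [List.flatten_cons, List.mem_append]; exact Or.inr this)
              c (by simp)).symm
          · simp only [List.head?_cons, Option.mem_def, Option.some.injEq] at hy
            subst hy
            exact hadj x (by simp [List.mem_of_mem_getLast? hx]) _ (by simp)
        · simp only [List.flatten_cons, List.append_assoc, List.cons_append] at h2 ⊢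
          refine List.Perm.append_left τ₁ ?_
          refine (List.Perm.cons c h2).trans ?_
          exact List.perm_middle.symm
        · simp at h3 ⊢; omega
        · intro σ hσ x hx
          rcases List.mem_cons.1 hσ with rfl | hσ
          · rw [List.head?_append_of_ne_nil _ hne₁] at hx
            simp [List.mem_of_mem_head? hx]
          · have := h4 σ (by simp [hσ]) x hx
            simp only [List.flatten_cons, List.mem_append]
            exact Or.inr this

variable [DecidableEq V]

lemma HasPathCover.union {A B : Finset V} (hA : HasPathCover G A) (hB : HasPathCover G B)
    (hAB : Disjoint A B) (hno : ∀ a ∈ A, ∀ b ∈ B, ¬ G.Adj a b) :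
    HasPathCover G (A ∪ B) := by
  obtain ⟨P, W, φ, h1, h2, h3, h4, h5, h6, h7⟩ := hA
  obtain ⟨Q, X, ψ, k1, k2, k3, k4, k5, k6, k7⟩ := hB
  rw [Finset.disjoint_left] at hAB
  refine ⟨P ++ Q, W ∪ X, fun v => if v ∈ A then φ v else ψ v, ?_, ?_, ?_,
    Finset.union_subset_union h4 k4, ?_, ?_, ?_⟩
  · intro τ hτ
    rcases List.mem_append.1 hτ with hτ | hτ
    · exact h1 τ hτ
    · exact k1 τ hτ
  · rw [List.flatten_append, List.nodup_append']
    exact ⟨h2, k2, fun v hv hv' => hAB ((h3 v).1 hv) ((k3 v).1 hv')⟩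
  · intro v
    rw [List.flatten_append, List.mem_append, h3, k3, Finset.mem_union]
  · intro v hv hvW
    grind
  · intro u hu huW v hv hvW huv
    have := hno u
    have := hno v
    have := huv.symm
    grind
  · have e1 : ((A ∪ B) \ (W ∪ X)).image (fun v => if v ∈ A then φ v else ψ v) =
        (A \ W).image φ ∪ (B \ X).image ψ := by
      ext x
      simp only [Finset.mem_image, Finset.mem_union, Finset.mem_sdiff]
      constructor
      · rintro ⟨v, hv, rfl⟩
        by_cases hvA : v ∈ A
        · exact Or.inl ⟨v, by grind, by simp [hvA]⟩
        · exact Or.inr ⟨v, by grind, by simp [hvA]⟩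
      · rintro (⟨v, hv, rfl⟩ | ⟨v, hv, rfl⟩)
        · exact ⟨v, by grind, by simp [hv.1]⟩
        · exact ⟨v, by grind, by simp [show v ∉ A from fun h => hAB h hv.1]⟩
    rw [e1, Finset.card_union_of_disjoint, Finset.card_union_of_disjoint, List.length_append]
    · omega
    · rw [Finset.disjoint_left]
      simp only [Finset.mem_image, Finset.mem_sdiff]
      rintro _ ⟨v, hv, rfl⟩ ⟨w, hw, he⟩
      exact hAB (h5 v hv.1 hv.2) (he ▸ k5 w hw.1 hw.2)
    · exact Finset.disjoint_left.2 fun v hv hv' => hAB (h4 hv) (k4 hv')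

private lemma HasPathCover.join_aux {A B : Finset V} (hB : HasPathCover G B)
    (hAB : Disjoint A B) (hadj : ∀ a ∈ A, ∀ b ∈ B, G.Adj a b) (hA : A.Nonempty)
    (hle : A.card ≤ B.card) :
    HasPathCover G (A ∪ B) := by
  have hAB' := Finset.disjoint_left.1 hAB
  obtain ⟨P, W, φ, h1, h2, h3, h4, h5, h6, h7⟩ := hB
  rcases Nat.lt_or_ge A.card P.length with h8 | hPA
  · obtain ⟨P', k1, k2, k3, -⟩ := h1.interleave (s := A.toList) (by simpa using h8)
      (fun x hx y hy => (hadj y (by simpa using hy) x ((h3 x).1 hx)).symm)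
    refine ⟨P', A ∪ W, φ, k1, ?_, ?_, by grind, by grind, by grind, ?_⟩
    · rw [k2.nodup_iff, List.nodup_append']
      exact ⟨h2, A.nodup_toList, fun v hv hv' => hAB' (by simpa using hv') ((h3 v).1 hv)⟩
    · intro v
      rw [k2.mem_iff, List.mem_append, h3, Finset.mem_toList, Finset.mem_union, or_comm]
    · have e : (A ∪ B) \ (A ∪ W) = B \ W := by ext v; grind
      rw [e, Finset.card_union_of_disjoint (hAB.mono_right h4)]
      rw [Finset.length_toList] at k3
      omega
  · have hlen : P.flatten.length = B.card := by
      rw [← List.toFinset_card_of_nodup h2]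
      congr 1
      ext v; simp only [List.mem_toFinset, h3]
    obtain ⟨P', k1, k2, k3⟩ := h1.split hPA (by omega)
    obtain ⟨c, s, hs⟩ : ∃ c s, A.toList = c :: s := by
      rcases hl : A.toList with _ | ⟨c, s⟩
      · simp only [Finset.toList_eq_nil] at hl
        simp [hl] at hA
      · exact ⟨c, s, rfl⟩
    have hmem : ∀ v, v ∈ c :: s ↔ v ∈ A := fun v => by rw [← hs, Finset.mem_toList]
    have hcard : s.length + 1 = A.card := by rw [← Finset.length_toList, hs]; rfl
    have hnod : (c :: s).Nodup := hs ▸ A.nodup_toList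
    obtain ⟨P'', m1, m2, m3, m4⟩ := k1.interleave (s := s) (by omega)
      (fun x hx y hy => (hadj y ((hmem y).1 (by simp [hy])) x ((h3 x).1 (k2 ▸ hx))).symm)
    obtain ⟨τ, rfl⟩ := List.length_eq_one_iff.1 (show P''.length = 1 by omega)
    obtain ⟨a, ha⟩ := hA
    simp only [List.flatten_singleton] at m2
    have hperm : (c :: τ).Perm (P.flatten ++ c :: s) := by
      rw [k2] at m2
      exact (m2.cons c).trans List.perm_middle.symm
    refine ⟨[c :: τ], ∅, fun _ => a, ?_, ?_, ?_, by simp, by simp [ha], by simp, ?_⟩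
    · intro σ hσ
      rw [List.mem_singleton] at hσ
      subst hσ
      refine ⟨by simp, List.isChain_cons.2 ⟨fun y hy => ?_, (m1 τ (by simp)).2⟩⟩
      have := m4 τ (by simp) y hy
      rw [k2, h3] at this
      exact hadj c ((hmem c).1 (by simp)) y this
    · rw [List.flatten_singleton, hperm.nodup_iff, List.nodup_append']
      exact ⟨h2, hnod, fun v hv hv' => hAB' ((hmem v).1 hv') ((h3 v).1 hv)⟩
    · intro v
      rw [List.flatten_singleton, hperm.mem_iff, List.mem_append, h3, hmem, Finset.mem_union,
        or_comm]
    · have : ((A ∪ B) \ ∅).Nonempty := ⟨a, by simp [ha]⟩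
      rw [Finset.image_const this]
      simp

lemma HasPathCover.join {A B : Finset V} (hA : HasPathCover G A) (hB : HasPathCover G B)
    (hAB : Disjoint A B) (hadj : ∀ a ∈ A, ∀ b ∈ B, G.Adj a b) (hAne : A.Nonempty)
    (hBne : B.Nonempty) : HasPathCover G (A ∪ B) := by
  rcases le_total A.card B.card with h | h
  · exact hB.join_aux hAB hadj hAne h
  · rw [Finset.union_comm]
    exact hA.join_aux hAB.symm (fun b hb a ha => (hadj a ha b hb).symm) hBne h

/-- A graph without induced `P₄` can be partitioned into as many paths as its scattering number
allows. -/
theorem P4FreeOn.hasPathCover (Y : Finset V) (hY : P4FreeOn G (Y : Set V)) :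
    HasPathCover G Y := by
  induction Y using Finset.strongInduction with
  | H Y ih =>
    rcases Nat.lt_or_ge Y.card 2 with h2 | h2
    · rcases Nat.lt_or_ge Y.card 1 with h1 | h1
      · obtain rfl := Finset.card_eq_zero.1 (show Y.card = 0 by omega)
        exact ⟨[], ∅, id, by simp [PathSystem], by simp, by simp, by simp, by simp, by simp,
          by simp⟩
      · obtain ⟨v, rfl⟩ := Finset.card_eq_one.1 (show Y.card = 1 by omega)
        exact ⟨[[v]], ∅, id, by simp [PathSystem], by simp, by simp, by simp, by simp, by simp,
          by simp⟩
    · obtain ⟨A, B, hA, hB, hAB, rfl, h⟩ := hY.exists_split _ h2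
      have hdis := Finset.disjoint_left.1 hAB
      obtain ⟨a, ha⟩ := id hA
      obtain ⟨b, hb⟩ := id hB
      have hcA := ih A ⟨Finset.subset_union_left, fun hs =>
        hdis (hs (Finset.mem_union_right _ hb)) hb⟩ (hY.mono (by simp))
      have hcB := ih B ⟨Finset.subset_union_right, fun hs =>
        hdis ha (hs (Finset.mem_union_left _ ha))⟩ (hY.mono (by simp))
      rcases h with h | h
      · exact hcA.union hcB hAB h
      · exact hcA.join hcB hAB h hA hB

end PathCover

/-- `l` is a list from `a` to `b` whose consecutive members are related by `r`. -/
def IsPathList {V : Type*} (r : V → V → Prop) (a : V) (l : List V) (b : V) : Prop :=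
  l.IsChain r ∧ l.head? = some a ∧ l.getLast? = some b

/-- `l` lists the members of a closed `r`-chain in their cyclic order. -/
def IsCycleList {V : Type*} (r : V → V → Prop) (l : List V) : Prop :=
  ∃ a b, IsPathList r a l b ∧ r b a

section PathList

variable {V : Type*} {r r' : V → V → Prop} {a b c d : V} {l m : List V}

lemma IsPathList.ne_nil (h : IsPathList r a l b) : l ≠ [] := by
  rintro rfl
  simp [IsPathList] at h

lemma IsPathList.head_mem (h : IsPathList r a l b) : a ∈ l :=
  List.mem_of_mem_head? h.2.1

lemma IsPathList.last_mem (h : IsPathList r a l b) : b ∈ l :=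
  List.mem_of_mem_getLast? h.2.2

lemma IsPathList.mono (hr : ∀ x y, r x y → r' x y) (h : IsPathList r a l b) :
    IsPathList r' a l b :=
  ⟨h.1.imp hr, h.2⟩

lemma IsPathList.append (h : IsPathList r a l b) (h' : IsPathList r c m d) (hr : r b c) :
    IsPathList r a (l ++ m) d := by
  refine ⟨List.isChain_append.2 ⟨h.1, h'.1, fun x hx y hy => ?_⟩, ?_, ?_⟩
  · rw [h.2.2] at hx
    rw [h'.2.1] at hy
    simp only [Option.mem_def, Option.some.injEq] at hx hy
    exact hx ▸ hy ▸ hr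
  · simp [List.head?_append, h.2.1]
  · simp [List.getLast?_append, h'.2.2]

lemma IsPathList.reverse (hr : ∀ x y, r x y → r y x) (h : IsPathList r a l b) :
    IsPathList r b l.reverse a :=
  ⟨List.isChain_reverse.2 (h.1.imp hr), by simp [h.2.2], by simp [h.2.1]⟩

lemma IsPathList.singleton : IsPathList r a [a] a := by
  simp [IsPathList]

lemma IsPathList.cons (h : IsPathList r b l c) (hr : r a b) : IsPathList r a (a :: l) c :=
  IsPathList.singleton.append h hr

lemma exists_isPathList (h : l.IsChain r) (hl : l ≠ []) : ∃ a b, IsPathList r a l b :=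
  ⟨l.head hl, l.getLast hl, h, List.head?_eq_some_head hl, List.getLast?_eq_some_getLast hl⟩

lemma IsPathList.split (h : IsPathList r a (l ++ m) b) (hl : l ≠ []) (hm : m ≠ []) :
    ∃ c d, IsPathList r a l c ∧ IsPathList r d m b ∧ r c d := by
  obtain ⟨h1, h2, h3⟩ := h
  obtain ⟨h4, h5, h6⟩ := List.isChain_append.1 h1
  obtain ⟨a', c, hl'⟩ := exists_isPathList h4 hl
  obtain ⟨d, b', hm'⟩ := exists_isPathList h5 hm
  rw [List.head?_append, hl'.2.1] at h2
  rw [List.getLast?_append, hm'.2.2] at h3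
  simp only [Option.some_or, Option.some.injEq] at h2 h3
  subst h2 h3
  exact ⟨c, d, hl', hm', h6 c hl'.2.2 d hm'.2.1⟩

lemma IsCycleList.mono (hr : ∀ x y, r x y → r' x y) (h : IsCycleList r l) :
    IsCycleList r' l := by
  obtain ⟨a, b, h1, h2⟩ := h
  exact ⟨a, b, h1.mono hr, hr _ _ h2⟩

lemma IsCycleList.rotate (h : IsCycleList r (l ++ m)) : IsCycleList r (m ++ l) := by
  rcases eq_or_ne l [] with rfl | hl
  · simpa using h
  rcases eq_or_ne m [] with rfl | hm
  · simpa using h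
  obtain ⟨a, b, h1, h2⟩ := h
  obtain ⟨c, d, h3, h4, h5⟩ := h1.split hl hm
  exact ⟨d, c, h4.append h3 h2, h5⟩

lemma IsCycleList.exists_rotate (h : IsCycleList r l) (ha : a ∈ l) :
    ∃ m b, m.Perm l ∧ IsPathList r a m b ∧ r b a := by
  obtain ⟨l₁, l₂, rfl⟩ := List.append_of_mem ha
  obtain ⟨a', b, h1, h2⟩ := h.rotate
  obtain rfl : a = a' := by simpa [IsPathList] using h1.2.1
  exact ⟨_, b, List.perm_append_comm, h1, h2⟩

end PathList

/-- Adjacency with the restriction that the members of `U` are entered only from `T`. -/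
def EntryAdj {V : Type*} (G : SimpleGraph V) (T U : Finset V) (a b : V) : Prop :=
  G.Adj a b ∧ (b ∈ U → a ∈ T)

/-- The list `l` is a longest cycle of `G`, the set `H` induces a component outside the cycle,
`T` is the set of attachments of `H` and `U` the set of their successors on the cycle. -/
structure CycleComponent {V : Type*} (G : SimpleGraph V) (l : List V) (H T U : Finset V) :
    Prop where
  nodup : l.Nodup
  cycle : IsCycleList (EntryAdj G T U) l
  longest : ∀ m : List V, m.Nodup → IsCycleList G.Adj m → m.length ≤ l.length
  notMem : ∀ v ∈ l, v ∉ H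
  mem_of_mem_T : ∀ v ∈ T, v ∈ l
  mem_of_mem_U : ∀ v ∈ U, v ∈ l
  card_U : U.card = T.card
  detour : ∀ s ∈ T, ∀ r ∈ T, ∃ (η : List V) (a b : V), η.Nodup ∧ (∀ x ∈ η, x ∈ H) ∧
    IsPathList G.Adj a η b ∧ G.Adj s a ∧ G.Adj b r
  not_adj : ∀ v, v ∉ H → v ∉ T → ∀ h ∈ H, ¬ G.Adj v h
  free : P4FreeOn G {v | v ∉ H ∧ v ∉ T}

namespace CycleComponent

variable {V : Type*} {G : SimpleGraph V} {l : List V} {H T U : Finset V}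

lemma disjoint_T_U (C : CycleComponent G l H T U) {u : V} (hu : u ∈ U) : u ∉ T := by
  intro huT
  obtain ⟨m, s, hm, h1, h2⟩ := C.cycle.exists_rotate (C.mem_of_mem_U u hu)
  obtain ⟨η, a, b, k1, k2, k3, k4, k5⟩ := C.detour s (h2.2 hu) u huT
  have := C.longest (m ++ η) ?_ ⟨_, _, (h1.mono fun _ _ h => h.1).append k3 k4, k5⟩
  · rw [List.length_append, hm.length_eq] at this
    exact k3.ne_nil (List.length_eq_zero_iff.1 (by omega))
  · rw [List.nodup_append']
    exact ⟨hm.nodup_iff.2 C.nodup, k1, fun v hv hv' => C.notMem v (hm.mem_iff.1 hv) (k2 v hv')⟩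

/-- Two successors of attachments are joined by a path longer than the cycle. -/
lemma exists_long_path (C : CycleComponent G l H T U) {u v : V} (hu : u ∈ U) (hv : v ∈ U)
    (huv : u ≠ v) :
    ∃ m : List V, m.Nodup ∧ IsPathList G.Adj u m v ∧ l.length < m.length ∧
      ∀ x ∈ m, x ∈ l ∨ x ∈ H := by
  obtain ⟨m, s, hm, h1, h2⟩ := C.cycle.exists_rotate (C.mem_of_mem_U u hu)
  obtain ⟨A, B, rfl⟩ := List.append_of_mem (hm.mem_iff.2 (C.mem_of_mem_U v hv))
  have hA : A ≠ [] := by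
    rintro rfl
    exact huv (by simpa [IsPathList] using h1.2.1.symm)
  obtain ⟨r, v', h3, h4, h5⟩ := h1.split hA (by simp)
  obtain rfl : v = v' := by simpa [IsPathList] using h4.2.1
  obtain ⟨η, a, b, k1, k2, k3, k4, k5⟩ := C.detour r (h5.2 hv) s (h2.2 hu)
  have hadj : ∀ x y, EntryAdj G T U x y → G.Adj x y := fun _ _ h => h.1
  have hperm : (A ++ η ++ (v :: B).reverse).Perm ((A ++ v :: B) ++ η) := by
    rw [List.append_assoc, List.append_assoc]
    exact List.Perm.append_left _
      (List.perm_append_comm.trans ((List.reverse_perm _).append_right _))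
  refine ⟨A ++ η ++ (v :: B).reverse, ?_, ((h3.mono hadj).append k3 k4).append
    ((h4.mono hadj).reverse fun _ _ h => h.symm) k5, ?_, ?_⟩
  · rw [hperm.nodup_iff, List.nodup_append']
    exact ⟨hm.nodup_iff.2 C.nodup, k1, fun v hv hv' => C.notMem v (hm.mem_iff.1 hv) (k2 v hv')⟩
  · rw [hperm.length_eq, List.length_append, hm.length_eq]
    have := List.length_pos_iff.2 k3.ne_nil
    omega
  · intro x hx
    rw [hperm.mem_iff, List.mem_append, hm.mem_iff] at hx
    exact hx.imp id (k2 x)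

lemma not_adj_U (C : CycleComponent G l H T U) {u v : V} (hu : u ∈ U) (hv : v ∈ U) :
    ¬ G.Adj u v := by
  intro huv
  obtain ⟨m, h1, h2, h3, -⟩ := C.exists_long_path hu hv huv.ne
  exact absurd (C.longest m h1 ⟨u, v, h2, huv.symm⟩) (by omega)

lemma mem_of_adj_U (C : CycleComponent G l H T U) {u v x : V} (hu : u ∈ U) (hv : v ∈ U)
    (huv : u ≠ v) (hxH : x ∉ H) (hxu : G.Adj x u) (hxv : G.Adj x v) : x ∈ l := by
  by_contra hxl
  obtain ⟨m, h1, h2, h3, h4⟩ := C.exists_long_path hu hv huv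
  have := C.longest (x :: m) (List.nodup_cons.2 ⟨fun hx => (h4 x hx).elim hxl hxH, h1⟩)
    ⟨x, v, h2.cons hxu, hxv.symm⟩
  rw [List.length_cons] at this
  omega

/-- The vertices outside `H ∪ T` with two neighbours in `U`. -/
def Rich (G : SimpleGraph V) (H T U : Finset V) (x : V) : Prop :=
  (x ∉ H ∧ x ∉ T) ∧ ∃ u ∈ U, ∃ v ∈ U, u ≠ v ∧ G.Adj x u ∧ G.Adj x v

lemma Rich.mem (C : CycleComponent G l H T U) {x : V} (hx : Rich G H T U x) : x ∈ l := by
  obtain ⟨⟨h1, -⟩, u, hu, v, hv, huv, h3, h4⟩ := hx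
  exact C.mem_of_adj_U hu hv huv h1 h3 h4

lemma Rich.notMem_U (C : CycleComponent G l H T U) {x : V} (hx : Rich G H T U x) :
    x ∉ U := by
  intro hxU
  obtain ⟨-, u, hu, -, -, -, h3, -⟩ := hx
  exact C.not_adj_U hxU hu h3

lemma outside_of_mem_U (C : CycleComponent G l H T U) {u : V} (hu : u ∈ U) :
    u ∉ H ∧ u ∉ T :=
  ⟨C.notMem u (C.mem_of_mem_U u hu), C.disjoint_T_U hu⟩

/-- The ends of a long enough path through `U` cannot cross over `U`. -/
lemma not_crossing (C : CycleComponent G l H T U) {y z u v : V} {A B D : List V}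
    (hnd : (A ++ (u :: B) ++ v :: D).Nodup) (hH : ∀ x ∈ A ++ (u :: B) ++ v :: D, x ∉ H)
    (hlen : l.length ≤ (A ++ (u :: B) ++ v :: D).length)
    (hm : IsPathList (EntryAdj G T U) y (A ++ (u :: B) ++ v :: D) z) (hyU : y ∉ U)
    (hu : u ∈ U) (hv : v ∈ U) (hyv : G.Adj y v) : ¬ G.Adj z u := by
  intro hzu
  have hA : A ≠ [] := by
    rintro rfl
    obtain rfl : u = y := by simpa [IsPathList] using hm.2.1
    exact hyU hu
  obtain ⟨r, v', h1, h2, h3⟩ := hm.split (by simp) (by simp)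
  obtain rfl : v = v' := by simpa [IsPathList] using h2.2.1
  obtain ⟨s, u', h4, h5, h6⟩ := h1.split hA (by simp)
  obtain rfl : u = u' := by simpa [IsPathList] using h5.2.1
  obtain ⟨η, a, b, k1, k2, k3, k4, k5⟩ := C.detour s (h6.2 hu) r (h3.2 hv)
  have hadj : ∀ x y, EntryAdj G T U x y → G.Adj x y := fun _ _ h => h.1
  have hsymm : ∀ x y, G.Adj x y → G.Adj y x := fun _ _ h => h.symm
  have hperm : (A ++ η ++ (u :: B).reverse ++ (v :: D).reverse).Perm
      ((A ++ (u :: B) ++ v :: D) ++ η) := by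
    simp only [List.append_assoc]
    refine List.Perm.append_left _ (List.perm_append_comm.trans ?_)
    rw [List.append_assoc]
    exact (List.reverse_perm _).append ((List.reverse_perm _).append_right _)
  have := C.longest (A ++ η ++ (u :: B).reverse ++ (v :: D).reverse) ?_
    ⟨y, v, (((h4.mono hadj).append k3 k4).append ((h5.mono hadj).reverse hsymm) k5).append
      ((h2.mono hadj).reverse hsymm) hzu.symm, hyv.symm⟩
  · rw [hperm.length_eq, List.length_append] at this
    exact k3.ne_nil (List.length_eq_zero_iff.1 (by omega))
  · rw [hperm.nodup_iff, List.nodup_append']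
    exact ⟨hnd, k1, fun v hv hv' => hH v hv (k2 v hv')⟩

/-- The ends of a path avoiding `H`, covering the cycle and entering `U` only from `T` cannot both
be rich and close to each other. -/
lemma false_of_rich_ends (C : CycleComponent G l H T U) {y z : V} {m : List V} (hnd : m.Nodup)
    (hH : ∀ x ∈ m, x ∉ H) (hl : ∀ x ∈ l, x ∈ m) (hm : IsPathList (EntryAdj G T U) y m z)
    (hy : Rich G H T U y) (hz : Rich G H T U z)
    (hyz : G.Adj y z ∨ ∃ q, q ∉ H ∧ q ∉ T ∧ ¬ Rich G H T U q ∧ G.Adj y q ∧ G.Adj z q) :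
    False := by
  have hlen : l.length ≤ m.length := (List.subperm_of_subset C.nodup hl).length_le
  have hcross : ∀ u ∈ U, ∀ v ∈ U, [u, v].Sublist m → G.Adj y v → ¬ G.Adj z u := by
    intro u hu v hv huv hyv
    obtain ⟨A, m', rfl, h1, h2⟩ := List.cons_sublist_iff.1 huv
    obtain ⟨A₁, A₂, rfl⟩ := List.append_of_mem h1
    obtain ⟨B, D, rfl⟩ := List.append_of_mem (List.singleton_sublist.1 h2)
    have e : A₁ ++ u :: A₂ ++ (B ++ v :: D) = A₁ ++ (u :: (A₂ ++ B)) ++ v :: D := by simp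
    rw [e] at hnd hH hlen hm
    exact C.not_crossing hnd hH hlen hm (Rich.notMem_U C hy) hu hv hyv
  have hord : ∀ u ∈ U, ∀ v ∈ U, u ≠ v → [u, v].Sublist m ∨ [v, u].Sublist m := by
    intro u hu v hv huv
    obtain ⟨A, B, rfl⟩ := List.append_of_mem (hl u (C.mem_of_mem_U u hu))
    have hv' := hl v (C.mem_of_mem_U v hv)
    rw [List.mem_append, List.mem_cons] at hv'
    rcases hv' with hv' | rfl | hv'
    · right
      exact (List.singleton_sublist.2 hv').append
        (List.singleton_sublist.2 (List.mem_cons_self (a := u) (l := B)))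
    · exact absurd rfl huv
    · left
      exact ((List.singleton_sublist.2 hv').cons_cons u).trans (List.sublist_append_right _ _)
  have hpair : ∀ x, Rich G H T U x → ∃ u ∈ U, ∃ v ∈ U, u ≠ v ∧ [u, v].Sublist m ∧
      G.Adj x u ∧ G.Adj x v := by
    rintro x ⟨-, u, hu, v, hv, huv, h1, h2⟩
    rcases hord u hu v hv huv with h | h
    · exact ⟨u, hu, v, hv, huv, h, h1, h2⟩
    · exact ⟨v, hv, u, hu, huv.symm, h, h2, h1⟩
  obtain ⟨v₁, hv₁, v₂, hv₂, -, hv, hyv₁, hyv₂⟩ := hpair y hy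
  obtain ⟨u₁, hu₁, u₂, hu₂, -, hu, hzu₁, hzu₂⟩ := hpair z hz
  have hzv : ¬ G.Adj z v₁ := hcross v₁ hv₁ v₂ hv₂ hv hyv₂
  have hyu : ¬ G.Adj y u₂ := fun h => hcross u₁ hu₁ u₂ hu₂ hu h hzu₁
  have hne : v₁ ≠ u₂ := by
    rintro rfl
    exact hyu hyv₁
  have hind := C.not_adj_U hv₁ hu₂
  have hYv := C.outside_of_mem_U hv₁
  have hYu := C.outside_of_mem_U hu₂
  by_cases hadj : G.Adj y z
  · exact hind (C.free hYv hy.1 hz.1 hYu hyv₁.symm hadj hzu₂ (fun h => hzv h.symm) hyu)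
  · obtain ⟨q, hqH, hqT, hq, hyq, hzq⟩ := hyz.resolve_left hadj
    by_cases hqv : G.Adj v₁ q
    · have hqu : ¬ G.Adj u₂ q := fun h =>
        hq ⟨⟨hqH, hqT⟩, v₁, hv₁, u₂, hu₂, hne, hqv.symm, h.symm⟩
      exact hyu (C.free hYu hz.1 ⟨hqH, hqT⟩ hy.1 hzu₂.symm hzq hyq.symm hqu
        (fun h => hadj h.symm)).symm
    · exact hzv (C.free hYv hy.1 ⟨hqH, hqT⟩ hz.1 hyv₁.symm hyq hzq.symm hqv hadj).symm

end CycleComponent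

/-- A stretch of a walk: its first vertex, its inner vertices and its last vertex. -/
structure Segment (V : Type*) where
  /-- the first vertex -/
  fst : V
  /-- the inner vertices -/
  inner : List V
  /-- the last vertex -/
  snd : V

namespace Segment

variable {V : Type*} {r : V → V → Prop} {a b c : V} {D E : List (Segment V)}

/-- Consecutive members of `D` share their ends, and `D` leads from `a` to `b`. -/
noncomputable def Linked : V → List (Segment V) → V → Prop
  | a, [], b => a = b
  | a, d :: D, b => d.fst = a ∧ Linked d.snd D b

/-- The consecutive vertices of a segment are related by `r`. -/
def Chain (r : V → V → Prop) (d : Segment V) (σ : List V) : Prop :=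
  (d.fst :: (σ ++ [d.snd])).IsChain r

/-- The vertices of a list of segments, each without its last vertex. -/
def body (D : List (Segment V)) : List V := D.flatMap fun d => d.fst :: d.inner

lemma Linked.append (h : Linked a D b) (h' : Linked b E c) : Linked a (D ++ E) c := by
  induction D generalizing a with
  | nil => obtain rfl : a = b := h; exact h'
  | cons d D ih => exact ⟨h.1, ih h.2⟩

lemma Linked.of_append_cons {d : Segment V} (h : Linked a (D ++ d :: E) b) :
    Linked a D d.fst ∧ Linked d.snd E b := by
  induction D generalizing a with
  | nil => exact ⟨h.1.symm, h.2⟩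
  | cons e D ih => exact ⟨⟨h.1, (ih h.2).1⟩, (ih h.2).2⟩

lemma Linked.map_fst (h : Linked a D b) : a :: D.map snd = D.map fst ++ [b] := by
  induction D generalizing a with
  | nil => obtain rfl : a = b := h; rfl
  | cons d D ih =>
    rw [List.map_cons, List.map_cons, ih h.2, h.1]
    rfl

lemma Linked.perm_map (h : Linked a D a) : (D.map snd).Perm (D.map fst) := by
  have := h.map_fst
  exact (List.perm_cons a).1 (this ▸ List.perm_append_singleton a _)

/-- A closed list of segments may be opened at each of its members. -/
lemma Linked.exists_open {d : Segment V} (h : Linked a D a) (hd : d ∈ D) :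
    ∃ E, Linked d.snd E d.fst ∧ (d :: E).Perm D := by
  obtain ⟨D₁, D₂, rfl⟩ := List.append_of_mem hd
  obtain ⟨h1, h2⟩ := h.of_append_cons
  exact ⟨D₂ ++ D₁, h2.append h1, (List.perm_append_comm.cons d).trans List.perm_middle.symm⟩

/-- A walk can be cut at all of its vertices that satisfy `p`. -/
lemma exists_linked (p : V → Prop) {w z : V} {σ l : List V} (hw : p w) (hz : p z)
    (hσ : ∀ x ∈ σ, ¬ p x) (h : (w :: (σ ++ l ++ [z])).IsChain r) :
    ∃ D : List (Segment V), Linked w D z ∧ body D = w :: (σ ++ l) ∧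
      ∀ d ∈ D, p d.fst ∧ p d.snd ∧ (∀ x ∈ d.inner, ¬ p x) ∧ d.Chain r d.inner := by
  induction l generalizing w σ with
  | nil =>
    refine ⟨[⟨w, σ, z⟩], ⟨rfl, rfl⟩, by simp [body], ?_⟩
    simpa [hw, hz, Chain] using ⟨hσ, by simpa using h⟩
  | cons x l ih =>
    by_cases hx : p x
    · have h' : (w :: σ ++ x :: (l ++ [z])).IsChain r := by simpa using h
      obtain ⟨h1, h2⟩ := List.isChain_split.1 h'
      obtain ⟨D, h3, h4, h5⟩ := ih (σ := []) hx (by simp) (by simpa using h2)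
      refine ⟨⟨w, σ, x⟩ :: D, ⟨rfl, h3⟩, ?_, ?_⟩
      · simp only [body, List.flatMap_cons] at h4 ⊢
        simp [h4]
      · intro d hd
        rcases List.mem_cons.1 hd with rfl | hd
        · exact ⟨hw, hx, hσ, h1⟩
        · exact h5 d hd
    · obtain ⟨D, h1, h2, h3⟩ := ih (w := w) (σ := σ ++ [x]) hw
        (by simpa [or_imp, forall_and] using ⟨hσ, hx⟩) (by simpa using h)
      exact ⟨D, h1, by simpa using h2, h3⟩

/-- Paths can be inserted into the slots of a walk. -/
lemma exists_fill (slot : Segment V → Bool) (f : Segment V → List V) {P : List (List V)}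
    (hD : Linked a D b) (hkeep : ∀ d ∈ D, ¬ slot d → d.Chain r (f d))
    (hslot : ∀ d ∈ D, slot d → ∀ τ ∈ P, d.Chain r τ) (hcount : D.countP slot = P.length) :
    ∃ m : List V, IsPathList r a m b ∧
      m.Perm ((D.flatMap fun d => d.fst :: if slot d then [] else f d) ++ b :: P.flatten) := by
  induction D generalizing a P with
  | nil =>
    obtain rfl : a = b := hD
    obtain rfl : P = [] := List.length_eq_zero_iff.1 (by simpa using hcount.symm)
    exact ⟨[a], IsPathList.singleton, by simp⟩
  | cons d D ih =>
    obtain ⟨rfl, hD⟩ := hD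
    have happ : ∀ σ m, d.Chain r σ → IsPathList r d.snd m b →
        IsPathList r d.fst (d.fst :: σ ++ m) b := by
      intro σ m hσ hm
      have h1 : IsPathList r d.fst (d.fst :: σ ++ [d.snd]) d.snd :=
        ⟨hσ, rfl, List.getLast?_concat⟩
      obtain ⟨x, y, h2, h3, h4⟩ := h1.split (by simp) (by simp)
      obtain rfl : d.snd = y := by simpa [IsPathList] using h3.2.1
      exact h2.append hm h4
    by_cases hs : slot d
    · obtain _ | ⟨τ, P⟩ := P
      · simp [hs] at hcount
      obtain ⟨m, h1, h2⟩ := ih (P := P) hD (fun e he => hkeep e (by simp [he]))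
        (fun e he hse σ hσ => hslot e (by simp [he]) hse σ (by simp [hσ]))
        (by simpa [hs] using hcount)
      refine ⟨_, happ τ m (hslot d (by simp) hs τ (by simp)) h1, ?_⟩
      simp only [List.flatMap_cons, hs, if_true, List.flatten_cons, List.cons_append,
        List.nil_append]
      refine List.Perm.cons _ ((h2.append_left τ).trans ?_)
      rw [← List.append_assoc]
      refine (List.perm_append_comm.append_right _).trans ?_
      rw [List.append_assoc]
      exact List.perm_middle.append_left _
    · obtain ⟨m, h1, h2⟩ := ih (P := P) hD (fun e he => hkeep e (by simp [he]))
        (fun e he hse σ hσ => hslot e (by simp [he]) hse σ hσ)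
        (by simpa [hs] using hcount)
      refine ⟨_, happ (f d) m (hkeep d (by simp) hs) h1, ?_⟩
      simp only [List.flatMap_cons, hs, List.cons_append, List.append_assoc]
      exact List.Perm.cons _ (h2.append_left _)

lemma map_fst_sublist_body (D : List (Segment V)) : (D.map fst).Sublist (body D) := by
  induction D with
  | nil => simp [body]
  | cons d D ih =>
    simp only [body, List.flatMap_cons, List.map_cons, List.cons_append] at ih ⊢
    exact (ih.trans (List.sublist_append_right _ _)).cons_cons _

lemma eq_of_mem_inner (hD : (body D).Nodup) {d e : Segment V} (hd : d ∈ D) (he : e ∈ D) {v : V}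
    (hvd : v ∈ d.inner) (hve : v ∈ e.inner) : d = e := by
  by_contra hne
  have : Std.Symm (Function.onFun List.Disjoint fun d : Segment V => d.fst :: d.inner) :=
    ⟨fun _ _ h => List.Disjoint.symm h⟩
  exact (List.nodup_flatMap.1 hD).2.forall hd he hne (List.mem_cons_of_mem _ hvd)
    (List.mem_cons_of_mem _ hve)

lemma nodup_flatMap_of_subset (hD : (body D).Nodup) {g : Segment V → List V}
    (hg : ∀ d ∈ D, (g d).Nodup) (hsub : ∀ d ∈ D, ∀ x ∈ g d, x ∈ d.fst :: d.inner) :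
    (D.flatMap g).Nodup := by
  refine List.nodup_flatMap.2 ⟨hg, ((List.nodup_flatMap.1 hD).2).imp_of_mem ?_⟩
  intro d e hd he h x hx hx'
  exact h (hsub d hd x hx) (hsub e he x hx')

lemma length_le_flatMap {g : Segment V → List V} (hg : ∀ d ∈ D, g d ≠ []) :
    D.length ≤ (D.flatMap g).length := by
  induction D with
  | nil => simp
  | cons d D ih =>
    have h1 := List.length_pos_iff.2 (hg d (by simp))
    have h2 := ih fun e he => hg e (by simp [he])
    simp only [List.flatMap_cons, List.length_append, List.length_cons]
    omega

end Segment

namespace Segment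

variable {V : Type*} {r : V → V → Prop} {a b : V} {σ : List V} {d : Segment V}

lemma Chain.of_isPathList (h : IsPathList r a σ b) (ha : r d.fst a) (hb : r b d.snd) :
    d.Chain r σ :=
  ((h.append IsPathList.singleton hb).cons ha).1

lemma Chain.exists_isPathList (h : d.Chain r σ) (hσ : σ ≠ []) :
    ∃ a b, IsPathList r a σ b ∧ r d.fst a ∧ r b d.snd := by
  have h1 : IsPathList r d.fst ([d.fst] ++ (σ ++ [d.snd])) d.snd :=
    ⟨h, rfl, List.getLast?_concat (l := d.fst :: σ)⟩
  obtain ⟨x, y, h2, h3, h4⟩ := h1.split (by simp) (by simp)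
  obtain ⟨b, z, h5, h6, h7⟩ := h3.split hσ (by simp)
  obtain rfl : d.fst = x := by simpa [IsPathList] using h2.2.2
  obtain rfl : d.snd = z := by simpa [IsPathList] using h6.2.1
  exact ⟨y, b, h5, h4, h7⟩

end Segment

lemma P4FreeOn.near_of_isChain {V : Type*} {G : SimpleGraph V} {Y : Set V}
    (hY : P4FreeOn G Y) {z : V} (hz : z ∈ Y) {l : List V} (hl : l.IsChain G.Adj)
    (hlY : ∀ x ∈ l, x ∈ Y) (h : ∀ a ∈ l.head?, Near G Y z a) : ∀ x ∈ l, Near G Y z x := by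
  induction l with
  | nil => simp
  | cons a l ih =>
    have ha : Near G Y z a := h a rfl
    obtain ⟨h1, h2⟩ := List.isChain_cons.1 hl
    intro x hx
    rcases List.mem_cons.1 hx with rfl | hx
    · exact ha
    · refine ih h2 (fun x hx => hlY x (by simp [hx])) (fun b hb => ?_) x hx
      exact ha.adj hY hz (hlY a (by simp)) (hlY b (by simp [List.mem_of_mem_head? hb]))
        (h1 b hb)

namespace CycleComponent

open Segment

variable {V : Type*} {G : SimpleGraph V} {l : List V} {H T U : Finset V}

/-- The vertices outside `H ∪ T` with at most one neighbour in `U`. -/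
def Poor (G : SimpleGraph V) (H T U : Finset V) (x : V) : Prop :=
  (x ∉ H ∧ x ∉ T) ∧ ¬ Rich G H T U x

lemma poor_of_mem_U (C : CycleComponent G l H T U) {u : V} (hu : u ∈ U) :
    Poor G H T U u :=
  ⟨C.outside_of_mem_U hu, fun h => Rich.notMem_U C h hu⟩

lemma free_poor (C : CycleComponent G l H T U) : P4FreeOn G {v | Poor G H T U v} :=
  C.free.mono fun _ hv => hv.1

lemma not_near_U (C : CycleComponent G l H T U) {u v : V} (hu : u ∈ U) (hv : v ∈ U)
    (huv : u ≠ v) : ¬ Near G {v | Poor G H T U v} u v := by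
  rintro (h | h | ⟨q, hq, h1, h2⟩)
  · exact huv h
  · exact C.not_adj_U hu hv h
  · exact hq.2 ⟨hq.1, u, hu, v, hv, huv, h1.symm, h2⟩

/-- A rich vertex with a neighbour in a class of poor vertices is adjacent to the whole class. -/
lemma adj_of_near (C : CycleComponent G l H T U) {x q q' : V} (hx : Rich G H T U x)
    (hq : Poor G H T U q) (hq' : Poor G H T U q') (h : Near G {v | Poor G H T U v} q q')
    (hxq : G.Adj x q) : G.Adj x q' := by
  by_contra hxq'
  obtain ⟨d, hd, d', hd', hdd', hxd, hxd', -⟩ := h.exists_edge hq hq' hxq hxq'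
  obtain ⟨w, hw, hxw, hwd⟩ : ∃ w ∈ U, G.Adj x w ∧ ¬ Near G {v | Poor G H T U v} w d := by
    obtain ⟨-, u, hu, v, hv, huv, hxu, hxv⟩ := hx
    by_contra! hcon
    exact C.not_near_U hu hv huv ((hcon u hu hxu).trans C.free_poor (C.poor_of_mem_U hu) hd
      (C.poor_of_mem_U hv) (hcon v hv hxv).symm)
  refine hwd (Or.inr (Or.inr ⟨d', hd', ?_, hdd'.symm⟩))
  exact C.free (C.outside_of_mem_U hw) hx.1 hd.1 hd'.1 hxw.symm hxd hdd'
    (fun h => hwd (Or.inr (Or.inl h))) hxd'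

/-- The list `D` cuts the cycle at the members of `T` and at the rich vertices. -/
structure IsSegmentation (G : SimpleGraph V) (l : List V) (H T U : Finset V)
    (D : List (Segment V)) : Prop where
  linked : ∃ a, Linked a D a
  perm : (body D).Perm l
  fst : ∀ d ∈ D, d.fst ∈ T ∨ Rich G H T U d.fst
  snd : ∀ d ∈ D, d.snd ∈ T ∨ Rich G H T U d.snd
  poor : ∀ d ∈ D, ∀ x ∈ d.inner, Poor G H T U x
  chain : ∀ d ∈ D, d.Chain (EntryAdj G T U) d.inner

lemma exists_isSegmentation (C : CycleComponent G l H T U) (hT : T.Nonempty) :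
    ∃ D, IsSegmentation G l H T U D := by
  obtain ⟨s, hs⟩ := hT
  obtain ⟨m, b, hm, h1, h2⟩ := C.cycle.exists_rotate (C.mem_of_mem_T s hs)
  obtain _ | ⟨s', m⟩ := m
  · exact absurd rfl h1.ne_nil
  obtain rfl : s' = s := by simpa [IsPathList] using h1.2.1
  obtain ⟨D, h3, h4, h5⟩ := exists_linked (fun v => v ∈ T ∨ Rich G H T U v) (w := s') (z := s')
    (σ := []) (l := m) (Or.inl hs) (Or.inl hs) (by simp)
    (by simpa using (h1.append IsPathList.singleton h2).1)
  have hperm : (body D).Perm l := by rw [h4]; exact hm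
  refine ⟨D, ⟨s', h3⟩, hperm, fun d hd => (h5 d hd).1, fun d hd => (h5 d hd).2.1, ?_,
    fun d hd => (h5 d hd).2.2.2⟩
  intro d hd x hx
  have hxl : x ∈ l := hperm.mem_iff.1 (List.mem_flatMap.2 ⟨d, hd, by simp [hx]⟩)
  have := (h5 d hd).2.2.1 x hx
  exact ⟨⟨C.notMem x hxl, fun h => this (Or.inl h)⟩, fun h => this (Or.inr h)⟩

namespace IsSegmentation

variable {D : List (Segment V)}

lemma nodup_body (S : IsSegmentation G l H T U D) (C : CycleComponent G l H T U) :
    (body D).Nodup :=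
  S.perm.nodup_iff.2 C.nodup

lemma rich_fst (S : IsSegmentation G l H T U D) {d : Segment V} (hd : d ∈ D)
    (h : d.fst ∉ T) : Rich G H T U d.fst :=
  (S.fst d hd).resolve_left h

lemma rich_snd (S : IsSegmentation G l H T U D) {d : Segment V} (hd : d ∈ D)
    (h : d.snd ∉ T) : Rich G H T U d.snd :=
  (S.snd d hd).resolve_left h

/-- Rich vertices are never consecutive on the cycle. -/
lemma inner_ne_nil (S : IsSegmentation G l H T U D) (C : CycleComponent G l H T U)
    {d : Segment V} (hd : d ∈ D) (h1 : d.fst ∉ T) (h2 : d.snd ∉ T) : d.inner ≠ [] := by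
  intro hnil
  obtain ⟨a, ha⟩ := S.linked
  obtain ⟨E, hE, hperm⟩ := ha.exists_open hd
  obtain ⟨m, h3, h4⟩ := exists_fill (fun _ => false) inner (r := EntryAdj G T U) (P := []) hE
    (fun e he _ => S.chain e (hperm.mem_iff.1 (by simp [he]))) (by simp) (by simp)
  have hml : m.Perm l := by
    refine h4.trans (List.Perm.trans ?_ ((hperm.flatMap_right _).trans S.perm))
    simp only [List.flatten_nil, Bool.false_eq_true, if_false, List.flatMap_cons, hnil]
    exact List.perm_append_comm
  have hadj := S.chain d hd
  rw [hnil] at hadj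
  refine C.false_of_rich_ends (hml.nodup_iff.2 C.nodup)
    (fun x hx => C.notMem x (hml.mem_iff.1 hx)) (fun x hx => hml.mem_iff.2 hx) h3
    (S.rich_snd hd h2) (S.rich_fst hd h1) (Or.inl ?_)
  simp only [Segment.Chain, List.nil_append, List.isChain_cons_cons] at hadj
  exact hadj.1.1.symm

/-- The inside of a segment can be replaced by at most three of its vertices. -/
lemma exists_short (S : IsSegmentation G l H T U D) (C : CycleComponent G l H T U)
    {d : Segment V} (hd : d ∈ D) :
    ∃ ρ : List V, ρ.Nodup ∧ ρ.length ≤ 3 ∧ (∀ x ∈ ρ, x ∈ d.inner) ∧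
      d.Chain (EntryAdj G T U) ρ ∧ ∀ x ∈ d.inner, x ∈ U → x ∈ ρ ∧ d.fst ∈ T := by
  rcases eq_or_ne d.inner [] with hnil | hne
  · exact ⟨[], by simp, by simp, by simp, hnil ▸ S.chain d hd, by simp [hnil]⟩
  obtain ⟨a, b, h1, h2, h3⟩ := (S.chain d hd).exists_isPathList hne
  have hU : ∀ x ∈ d.inner, x ∈ U → x = a := by
    intro x hx hxU
    obtain ⟨A, B, hAB⟩ := List.append_of_mem hx
    rw [hAB] at h1
    rcases eq_or_ne A [] with rfl | hA
    · simpa [IsPathList] using h1.2.1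
    · obtain ⟨s, x', h4, h5, h6⟩ := h1.split hA (by simp)
      obtain rfl : x = x' := by simpa [IsPathList] using h5.2.1
      exact absurd (h6.2 hxU) (S.poor d hd s (by rw [hAB]; simp [h4.last_mem])).1.2
  have haσ := h1.head_mem
  have hbσ := h1.last_mem
  have hnear : Near G {x | x ∈ d.inner} a b := by
    refine (C.free_poor.mono (S.poor d hd)).near_of_isChain haσ (h1.1.imp fun _ _ h => h.1)
      (fun _ hx => hx) (fun c hc => ?_) b hbσ
    rw [h1.2.1] at hc
    exact Or.inl (by simpa using hc)
  have key : ∀ ρ : List V, ρ.Nodup → ρ.length ≤ 3 → (∀ x ∈ ρ, x ∈ d.inner) →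
      IsPathList (EntryAdj G T U) a ρ b → ∃ ρ : List V, ρ.Nodup ∧ ρ.length ≤ 3 ∧
        (∀ x ∈ ρ, x ∈ d.inner) ∧ d.Chain (EntryAdj G T U) ρ ∧ ∀ x ∈ d.inner, x ∈ U → x ∈ ρ ∧ d.fst ∈ T :=
    fun ρ h4 h5 h6 h7 => ⟨ρ, h4, h5, h6, Chain.of_isPathList h7 h2 h3,
      fun x hx hxU => by
        obtain rfl := hU x hx hxU
        exact ⟨h7.head_mem, h2.2 hxU⟩⟩
  have hentry : ∀ x y, G.Adj x y → y ∈ d.inner → y ≠ a → EntryAdj G T U x y :=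
    fun x y hxy hy hya => ⟨hxy, fun hyU => absurd (hU y hy hyU) hya⟩
  rcases eq_or_ne a b with rfl | hab
  · exact key [a] (by simp) (by simp) (by simpa using haσ) IsPathList.singleton
  rcases hnear with h | h | ⟨q, hq, h4, h5⟩
  · exact absurd h hab
  · exact key [a, b] (by simpa using hab) (by simp) (by simp [haσ, hbσ])
      (IsPathList.singleton.cons (hentry a b h hbσ hab.symm))
  · have hq : q ∈ d.inner := hq
    exact key [a, q, b] (by simp [h4.ne, hab, h5.ne]) (by simp) (by simp [haσ, hbσ, hq])
      ((IsPathList.singleton.cons (hentry q b h5 hbσ hab.symm)).cons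
        (hentry a q h4 hq h4.ne'))

variable [DecidableEq V]

/-- A segment with rich ends. -/
def isFree (T : Finset V) (d : Segment V) : Bool := d.fst ∉ T ∧ d.snd ∉ T

/-- The vertices of the shortened segments with an end in `T`. -/
def shortSet (T : Finset V) (D : List (Segment V)) (f : Segment V → List V) : Finset V :=
  ((D.filter fun d => !isFree T d).flatMap f).toFinset

lemma mem_shortSet {f : Segment V → List V} {v : V} :
    v ∈ shortSet T D f ↔ ∃ d ∈ D, ¬ isFree T d ∧ v ∈ f d := by
  simp [shortSet, and_assoc]

/-- The number of segments with rich ends is at most the size of any path partition of the poor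
vertices not in shortened segments. -/
lemma countP_isFree_le (S : IsSegmentation G l H T U D) (C : CycleComponent G l H T U)
    {f : Segment V → List V}
    (hf : ∀ d ∈ D, (f d).Nodup ∧ (f d).length ≤ 3 ∧ (∀ x ∈ f d, x ∈ d.inner) ∧
      d.Chain (EntryAdj G T U) (f d) ∧ ∀ x ∈ d.inner, x ∈ U → x ∈ f d ∧ d.fst ∈ T)
    {P : List (List V)} (hP : PathSystem G P) (hPnd : P.flatten.Nodup)
    (hPmem : ∀ v, v ∈ P.flatten ↔ Poor G H T U v ∧ v ∉ shortSet T D f) :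
    D.countP (isFree T) ≤ P.length := by
  by_contra! hlt
  obtain ⟨κ, hκ⟩ := C.free_poor.exists_label
  let lab : List V → Option V := fun σ => σ.head?.map κ
  have hlab : ∀ σ : List V, σ.IsChain G.Adj → (∀ x ∈ σ, Poor G H T U x) → ∀ x ∈ σ,
      lab σ = some (κ x) := by
    intro σ hσ hσY x hx
    obtain ⟨a, b, h⟩ := _root_.exists_isPathList hσ (List.ne_nil_of_mem hx)
    have hnear := C.free_poor.near_of_isChain (hσY a h.head_mem) hσ hσY
      (fun c hc => Or.inl (by rw [h.2.1] at hc; simpa using hc)) x hx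
    simp only [lab, h.2.1, Option.map_some, Option.some.injEq]
    exact (hκ a (hσY a h.head_mem) x (hσY x hx)).2 hnear
  have hPpoor : ∀ τ ∈ P, ∀ x ∈ τ, Poor G H T U x ∧ x ∉ shortSet T D f :=
    fun τ hτ x hx => (hPmem x).1 (List.mem_flatten.2 ⟨τ, hτ, hx⟩)
  have hlabP : ∀ τ ∈ P, ∀ x ∈ τ, lab τ = some (κ x) := fun τ hτ =>
    hlab τ (hP τ hτ).2 fun x hx => (hPpoor τ hτ x hx).1
  have hlabD : ∀ d ∈ D, ∀ x ∈ d.inner, lab d.inner = some (κ x) := by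
    intro d hd
    rcases eq_or_ne d.inner [] with hnil | hne
    · simp [hnil]
    obtain ⟨a, b, h1, -⟩ := (S.chain d hd).exists_isPathList hne
    exact hlab _ (h1.1.imp fun _ _ h => h.1) (S.poor d hd)
  obtain ⟨c, hc⟩ : ∃ c, (P.map lab).count c <
      ((D.filter (isFree T)).map fun d => lab d.inner).count c := by
    by_contra! hcon
    have := (List.subperm_ext_iff.2 fun c _ => hcon c).length_le
    rw [List.length_map, List.length_map, ← List.countP_eq_length_filter] at this
    omega
  let slot : Segment V → Bool := fun d => isFree T d ∧ lab d.inner = c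
  let Q := P.filter fun τ => lab τ = c
  have hc' : Q.length < D.countP slot := by
    have e1 : Q.length = (P.map lab).count c := by
      rw [← List.countP_eq_length_filter, List.count, List.countP_map]
      exact List.countP_congr fun τ _ => by simp
    have e2 : D.countP slot = ((D.filter (isFree T)).map fun d => lab d.inner).count c := by
      rw [List.count, List.countP_map, List.countP_filter]
      exact List.countP_congr fun τ _ => by simp [slot, and_comm]
    omega
  have hQ : PathSystem G Q := fun τ hτ => hP τ (List.mem_filter.1 hτ).1
  have hQmem : ∀ v, v ∈ Q.flatten ↔
      Poor G H T U v ∧ v ∉ shortSet T D f ∧ some (κ v) = c := by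
    intro v
    rw [← and_assoc, ← hPmem]
    simp only [List.mem_flatten, Q, List.mem_filter, decide_eq_true_eq]
    constructor
    · rintro ⟨τ, ⟨h1, h2⟩, h3⟩
      exact ⟨⟨τ, h1, h3⟩, by rw [← hlabP τ h1 v h3, h2]⟩
    · rintro ⟨⟨τ, h1, h3⟩, h2⟩
      exact ⟨τ, ⟨h1, by rw [hlabP τ h1 v h3, h2]⟩, h3⟩
  have hnd := S.nodup_body C
  have hslot : ∀ d, slot d ↔ (d.fst ∉ T ∧ d.snd ∉ T) ∧ lab d.inner = c := by
    simp [slot, isFree]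
  have hcover : ((D.filter slot).flatMap inner).length ≤ Q.flatten.length := by
    refine (List.subperm_of_subset ?_ ?_).length_le
    · exact (nodup_flatMap_of_subset (g := inner) hnd
        (fun d hd => ((List.nodup_flatMap.1 hnd).1 d hd).of_cons)
        (fun d _ x hx => by simp [hx])).sublist (List.filter_sublist.flatMap _)
    · intro v hv
      obtain ⟨d, hd, hv⟩ := List.mem_flatMap.1 hv
      obtain ⟨hd, hds⟩ := List.mem_filter.1 hd
      have hds' := (hslot d).1 hds
      refine (hQmem v).2 ⟨S.poor d hd v hv, fun hvS => ?_, by rw [← hlabD d hd v hv, hds'.2]⟩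
      obtain ⟨e, he, hef, hve⟩ := mem_shortSet.1 hvS
      obtain rfl := eq_of_mem_inner hnd hd he hv ((hf e he).2.2.1 v hve)
      exact hef (by simpa [isFree] using hds'.1)
  have hcount : D.countP slot ≤ Q.flatten.length := by
    rw [List.countP_eq_length_filter]
    refine (length_le_flatMap fun d hd => ?_).trans hcover
    obtain ⟨h1, h2⟩ := List.mem_filter.1 hd
    rw [hslot] at h2
    exact S.inner_ne_nil C h1 h2.1.1 h2.1.2
  obtain ⟨d, hd, hdslot⟩ := List.countP_pos_iff.1 (Nat.zero_lt_of_lt hc')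
  have hds := (hslot d).1 hdslot
  obtain ⟨a, ha⟩ := S.linked
  obtain ⟨E, hE, hperm⟩ := ha.exists_open hd
  have hED : ∀ e ∈ E, e ∈ D := fun e he => hperm.mem_iff.1 (by simp [he])
  have hEcount : E.countP slot + 1 = D.countP slot := by
    rw [← hperm.countP_eq, List.countP_cons_of_pos hdslot]
  obtain ⟨P', h1, h2, h3⟩ := hQ.split (k := E.countP slot) (by omega) (by omega)
  let g : Segment V → List V := fun d => if lab d.inner = c then f d else d.inner
  have hfst : ∀ e ∈ D, slot e → ∀ q, Poor G H T U q → some (κ q) = c →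
      G.Adj e.fst q ∧ G.Adj e.snd q := by
    intro e he hes q hq hqc
    obtain ⟨⟨h1, h2⟩, h3⟩ := (hslot e).1 hes
    obtain ⟨a, b, h4, h5, h6⟩ :=
      (S.chain e he).exists_isPathList (S.inner_ne_nil C he h1 h2)
    have hnear : ∀ x ∈ e.inner, Near G {v | Poor G H T U v} x q := fun x hx => by
      refine (hκ x (S.poor e he x hx) q hq).1 (Option.some.inj ?_)
      rw [← hlabD e he x hx, h3, hqc]
    exact ⟨C.adj_of_near (S.rich_fst he h1) (S.poor e he a h4.head_mem) hq
      (hnear a h4.head_mem) h5.1, C.adj_of_near (S.rich_snd he h2)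
      (S.poor e he b h4.last_mem) hq (hnear b h4.last_mem) h6.1.symm⟩
  have hmemU : ∀ v, v ∈ Q.flatten → v ∉ U := by
    intro v hv hvU
    obtain ⟨h6, h7, -⟩ := (hQmem v).1 hv
    obtain ⟨e, he, hve⟩ := List.mem_flatMap.1 (S.perm.mem_iff.2 (C.mem_of_mem_U v hvU))
    rcases List.mem_cons.1 hve with rfl | hve
    · exact (S.fst e he).elim h6.1.2 h6.2
    · obtain ⟨h8, h9⟩ := (hf e he).2.2.2.2 v hve hvU
      exact h7 (mem_shortSet.2 ⟨e, he, by simp [isFree, h9], h8⟩)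
  have hkeep : ∀ e ∈ E, ¬ slot e → e.Chain (EntryAdj G T U) (g e) := by
    intro e he _
    have heD := hED e he
    by_cases hec : lab e.inner = c
    · simpa [g, hec] using (hf e heD).2.2.2.1
    · simpa [g, hec] using S.chain e heD
  have hfill : ∀ e ∈ E, slot e → ∀ τ ∈ P', e.Chain (EntryAdj G T U) τ := by
    intro e he hes τ hτ
    have heD := hED e he
    obtain ⟨hne, hτc⟩ := h1 τ hτ
    have hτQ : ∀ x ∈ τ, x ∈ Q.flatten := fun x hx => by
      rw [← h2]
      exact List.mem_flatten.2 ⟨τ, hτ, hx⟩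
    have hadj : ∀ x ∈ τ, G.Adj e.fst x ∧ G.Adj e.snd x := fun x hx => by
      obtain ⟨h6, -, h7⟩ := (hQmem x).1 (hτQ x hx)
      exact hfst e heD hes x h6 h7
    obtain ⟨a, b, h6⟩ := _root_.exists_isPathList
      (r := EntryAdj G T U) (hτc.imp_of_mem_imp fun x y _ hy hxy =>
        ⟨hxy, fun hyU => absurd hyU (hmemU y (hτQ y hy))⟩) hne
    have hfree := ((hslot e).1 hes).1
    exact Chain.of_isPathList h6
      ⟨(hadj a h6.head_mem).1, fun h => absurd h (hmemU a (hτQ a h6.head_mem))⟩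
      ⟨(hadj b h6.last_mem).2.symm,
        fun h => absurd h (Rich.notMem_U C (S.rich_snd heD hfree.2))⟩
  obtain ⟨m, h4, h5⟩ := exists_fill slot g hE hkeep hfill h3.symm
  let g' : Segment V → List V := fun e => e.fst :: if slot e then [] else g e
  have hm : m.Perm (D.flatMap g' ++ Q.flatten) := by
    rw [h2] at h5
    refine h5.trans (List.Perm.trans ?_ ((hperm.flatMap_right g').append_right _))
    simp only [List.flatMap_cons, g', hdslot, if_true, List.cons_append, List.nil_append]
    exact List.perm_middle
  have hg' : ∀ e ∈ D, ∀ x ∈ g' e, x = e.fst ∨ x ∈ e.inner ∧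
      (x ∈ shortSet T D f ∨ some (κ x) ≠ c) := by
    intro e he x hx
    rcases List.mem_cons.1 hx with rfl | hx
    · exact Or.inl rfl
    right
    by_cases hes : slot e
    · simp [hes] at hx
    · simp only [hes, g] at hx
      by_cases hec : lab e.inner = c
      · simp only [hec, if_true, Bool.false_eq_true, if_false] at hx
        refine ⟨(hf e he).2.2.1 x hx, Or.inl (mem_shortSet.2 ⟨e, he, fun hef => hes ?_, hx⟩)⟩
        exact (hslot e).2 ⟨by simpa [isFree] using hef, hec⟩
      · simp only [hec, Bool.false_eq_true, if_false] at hx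
        exact ⟨hx, Or.inr (by rwa [← hlabD e he x hx])⟩
  have hbody : ∀ v ∈ l, ∃ e ∈ D, v = e.fst ∨ v ∈ e.inner := fun v hv => by
    simpa [body] using S.perm.mem_iff.2 hv
  have hfst' : ∀ e ∈ D, ¬ Poor G H T U e.fst := fun e he h =>
    (S.fst e he).elim h.1.2 h.2
  have hnodup : m.Nodup := by
    rw [hm.nodup_iff, List.nodup_append']
    refine ⟨nodup_flatMap_of_subset hnd (fun e he => ?_) (fun e he x hx => ?_),
      (List.filter_sublist.flatten).nodup hPnd, fun x hx hxQ => ?_⟩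
    · have hne := (List.nodup_flatMap.1 hnd).1 e he
      simp only [g', g]
      split_ifs
      · simp
      · refine List.nodup_cons.2 ⟨fun h => ?_, (hf e he).1⟩
        exact (List.nodup_cons.1 hne).1 ((hf e he).2.2.1 _ h)
      · exact hne
    · rw [List.mem_cons]
      exact (hg' e he x hx).imp_right And.left
    · obtain ⟨e, he, hxe⟩ := List.mem_flatMap.1 hx
      obtain ⟨h6, h7, h8⟩ := (hQmem x).1 hxQ
      rcases hg' e he x hxe with rfl | ⟨-, h | h⟩
      · exact hfst' e he h6
      · exact h7 h
      · exact h h8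
  have hmH : ∀ v ∈ m, v ∉ H := by
    intro v hv
    rw [hm.mem_iff, List.mem_append, List.mem_flatMap] at hv
    rcases hv with ⟨e, he, hve⟩ | hv
    · refine C.notMem v (S.perm.mem_iff.1 (List.mem_flatMap.2 ⟨e, he, ?_⟩))
      rw [List.mem_cons]
      exact (hg' e he v hve).imp_right And.left
    · exact ((hQmem v).1 hv).1.1.1
  have hlm : ∀ v ∈ l, v ∈ m := by
    intro v hv
    rw [hm.mem_iff, List.mem_append, List.mem_flatMap]
    obtain ⟨e, he, rfl | hve⟩ := hbody v hv
    · exact Or.inl ⟨e, he, by simp [g']⟩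
    have hlabe := hlabD e he v hve
    by_cases hec : lab e.inner = c
    · by_cases hvS : v ∈ shortSet T D f
      · left
        obtain ⟨e', he', hef', hve'⟩ := mem_shortSet.1 hvS
        obtain rfl := eq_of_mem_inner hnd he he' hve ((hf e' he').2.2.1 v hve')
        have hes : ¬ slot e := fun h => hef' (by simpa [isFree] using ((hslot e).1 h).1)
        exact ⟨e, he, by simp [g', g, hes, hec, hve']⟩
      · exact Or.inr ((hQmem v).2 ⟨S.poor e he v hve, hvS, by rw [← hlabe, hec]⟩)
    · have hes : ¬ slot e := fun h => hec ((hslot e).1 h).2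
      exact Or.inl ⟨e, he, by simp [g', g, hes, hec, hve]⟩
  obtain ⟨q, hq⟩ := List.exists_mem_of_ne_nil _ (S.inner_ne_nil C hd hds.1.1 hds.1.2)
  have hqp := S.poor d hd q hq
  have hqa := hfst d hd hdslot q hqp (by rw [← hlabD d hd q hq, hds.2])
  exact C.false_of_rich_ends hnodup hmH hlm h4 (S.rich_snd hd hds.1.2)
    (S.rich_fst hd hds.1.1) (Or.inr ⟨q, hqp.1.1, hqp.1.2, hqp.2, hqa.2, hqa.1⟩)

end IsSegmentation

end CycleComponent

/-- A labelling constant along the edges outside `W` has at most as many values as there are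
components outside `W`. -/
lemma card_image_compl_le_ncomps {V α : Type*} [Fintype V] [DecidableEq V] [DecidableEq α]
    {G : SimpleGraph V} (W : Finset V) (φ : V → α)
    (hφ : ∀ u ∉ W, ∀ v ∉ W, G.Adj u v → φ u = φ v) :
    (Wᶜ.image φ).card ≤ ncomps G (W : Set V) := by
  let g : (G.induce (W : Set V)ᶜ).ConnectedComponent → α :=
    ConnectedComponent.lift (fun v => φ v) (by
      intro v w p hp
      clear hp
      induction p with
      | nil => rfl
      | @cons a b _ h _ ih =>
        exact (hφ a a.2 b b.2 h).trans ih)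
  have hsub : ((Wᶜ.image φ : Finset α) : Set α) ⊆ Set.range g := by
    intro x hx
    obtain ⟨v, hv, rfl⟩ := Finset.mem_image.1 (Finset.mem_coe.1 hx)
    exact ⟨(G.induce (W : Set V)ᶜ).connectedComponentMk ⟨v, by simpa using hv⟩, rfl⟩
  calc (Wᶜ.image φ).card = ((Wᶜ.image φ : Finset α) : Set α).ncard :=
        (Set.ncard_coe_finset _).symm
    _ ≤ (Set.range g).ncard := Set.ncard_le_ncard hsub (Set.finite_range g)
    _ ≤ _ := Finite.card_range_le g

namespace CycleComponent

open Segment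

variable {V : Type*} {G : SimpleGraph V} {l : List V} {H T U : Finset V} {D : List (Segment V)}

section Counting

variable [DecidableEq V]

namespace IsSegmentation

lemma countP_fst (S : IsSegmentation G l H T U D) (C : CycleComponent G l H T U) :
    D.countP (fun d => d.fst ∈ T) = T.card := by
  have hnd : (D.map Segment.fst).Nodup := (map_fst_sublist_body D).nodup (S.nodup_body C)
  have h1 : D.countP (fun d => d.fst ∈ T) = ((D.map Segment.fst).filter (· ∈ T)).length := by
    rw [← List.countP_eq_length_filter, List.countP_map]
    rfl
  rw [h1, ← List.toFinset_card_of_nodup (hnd.filter _)]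
  congr 1
  ext v
  simp only [List.mem_toFinset, List.mem_filter, List.mem_map, decide_eq_true_eq,
    and_iff_right_iff_imp]
  intro hv
  obtain ⟨d, hd, hvd⟩ := List.mem_flatMap.1 (S.perm.mem_iff.2 (C.mem_of_mem_T v hv))
  rcases List.mem_cons.1 hvd with rfl | hvd
  · exact ⟨d, hd, rfl⟩
  · exact absurd hv (S.poor d hd v hvd).1.2

lemma countP_not_isFree_le (S : IsSegmentation G l H T U D) (C : CycleComponent G l H T U) :
    D.countP (fun d => !isFree T d) ≤ 2 * T.card := by
  have h1 : D.countP (fun d => d.snd ∈ T) = D.countP (fun d => d.fst ∈ T) := by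
    obtain ⟨a, ha⟩ := S.linked
    have := ha.perm_map.countP_eq (fun v => decide (v ∈ T))
    rwa [List.countP_map, List.countP_map] at this
  have h2 : ∀ E : List (Segment V), E.countP (fun d => !isFree T d) ≤
      E.countP (fun d => d.fst ∈ T) + E.countP (fun d => d.snd ∈ T) := by
    intro E
    induction E with
    | nil => simp
    | cons d E ih =>
      simp only [List.countP_cons, isFree]
      by_cases h3 : d.fst ∈ T <;> by_cases h4 : d.snd ∈ T <;> simp [h3, h4, isFree] at ih ⊢ <;>
        omega
  have := h2 D
  rw [h1, S.countP_fst C] at this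
  omega

lemma card_add_card_le (S : IsSegmentation G l H T U D) (C : CycleComponent G l H T U)
    {X : Finset V} (hX : ∀ v ∈ X, Rich G H T U v) : T.card + X.card ≤ D.length := by
  have hdis : Disjoint T X := Finset.disjoint_left.2 fun v hv hvX => (hX v hvX).1.2 hv
  rw [← Finset.card_union_of_disjoint hdis, ← List.length_map (f := Segment.fst) (as := D)]
  refine (Finset.card_le_card ?_).trans (List.toFinset_card_le _)
  intro v hv
  have hvl : v ∈ l := (Finset.mem_union.1 hv).elim (C.mem_of_mem_T v)
    fun h => Rich.mem C (hX v h)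
  obtain ⟨d, hd, hvd⟩ := List.mem_flatMap.1 (S.perm.mem_iff.2 hvl)
  rcases List.mem_cons.1 hvd with rfl | hvd
  · simpa using ⟨d, hd, rfl⟩
  · have := S.poor d hd v hvd
    exact ((Finset.mem_union.1 hv).elim this.1.2 fun h => this.2 (hX v h)).elim

lemma card_shortSet_le (S : IsSegmentation G l H T U D) (C : CycleComponent G l H T U)
    {f : Segment V → List V} (hf : ∀ d ∈ D, (f d).length ≤ 3) :
    (shortSet T D f).card ≤ 6 * T.card := by
  have h1 : ∀ E : List (Segment V), (∀ d ∈ E, (f d).length ≤ 3) →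
      (E.flatMap f).length ≤ 3 * E.length := by
    intro E hE
    induction E with
    | nil => simp
    | cons d E ih =>
      have h2 := ih fun e he => hE e (by simp [he])
      have h3 := hE d (by simp)
      simp only [List.flatMap_cons, List.length_append, List.length_cons]
      omega
  have h2 := h1 (D.filter fun d => !isFree T d) fun d hd => hf d (List.mem_filter.1 hd).1
  have h3 := S.countP_not_isFree_le C
  rw [List.countP_eq_length_filter] at h3
  exact (List.toFinset_card_le _).trans (by omega)

end IsSegmentation

end Counting

variable [Fintype V] [DecidableEq V]

/-- Toughness bounds the number of components outside a set `W` that contains `T` and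
avoids `H`. -/
lemma tough_bound (C : CycleComponent G l H T U) {t : ℝ} (htough : Tough t G)
    (hH : H.Nonempty) {W : Finset V} (hTW : T ⊆ W) (hWH : Disjoint W H) (φ : V → V)
    (hφ : ∀ u ∉ W, u ∉ H → ∀ v ∉ W, v ∉ H → G.Adj u v → φ u = φ v)
    (ht : 0 ≤ t) {Z : Finset V} (hZW : Disjoint Z W) (hZH : Disjoint Z H)
    (hZ : 1 ≤ (Z.image φ).card) :
    t * (1 + (Z.image φ).card) ≤ W.card := by
  let ψ : V → Option V := fun v => if v ∈ H then none else some (φ v)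
  have hψ : ∀ u ∉ W, ∀ v ∉ W, G.Adj u v → ψ u = ψ v := by
    intro u hu v hv huv
    have h1 : ∀ w ∉ W, w ∉ T := fun w hw h => hw (hTW h)
    by_cases huH : u ∈ H <;> by_cases hvH : v ∈ H
    · simp [ψ, huH, hvH]
    · exact absurd huv.symm (C.not_adj v hvH (h1 v hv) u huH)
    · exact absurd huv (C.not_adj u huH (h1 u hu) v hvH)
    · simp [ψ, huH, hvH, hφ u hu huH v hv hvH huv]
  have h1 := card_image_compl_le_ncomps W ψ hψ
  have h2 : 1 + (Z.image φ).card ≤ (Wᶜ.image ψ).card := by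
    have : insert none ((Z.image φ).map Function.Embedding.some) ⊆ Wᶜ.image ψ := by
      intro x hx
      rw [Finset.mem_insert, Finset.mem_map] at hx
      rw [Finset.mem_image]
      rcases hx with rfl | ⟨y, hy, rfl⟩
      · obtain ⟨h, hh⟩ := hH
        exact ⟨h, by simpa using Finset.disjoint_right.1 hWH hh, by simp [ψ, hh]⟩
      · obtain ⟨z, hz, rfl⟩ := Finset.mem_image.1 hy
        exact ⟨z, by simpa using Finset.disjoint_left.1 hZW hz,
          by simp [ψ, Finset.disjoint_left.1 hZH hz]⟩
    have := Finset.card_le_card this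
    rw [Finset.card_insert_of_notMem (by simp), Finset.card_map] at this
    omega
  have h3 := htough W (by omega)
  rw [Set.ncard_coe_finset] at h3
  have h4 : (1 + (Z.image φ).card : ℝ) ≤ ncomps G (W : Set V) := by exact_mod_cast h2.trans h1
  exact (mul_le_mul_of_nonneg_left h4 ht).trans h3

/-- In a tough graph no component outside a longest cycle can have attachments on the cycle. -/
theorem false_of_tough (C : CycleComponent G l H T U) {t : ℝ} (ht : 4.5 ≤ t)
    (htough : Tough t G) (hH : H.Nonempty) (hTH : Disjoint T H) (hT : T.Nonempty) : False := by
  classical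
  let X : Finset V := Finset.univ.filter (Rich G H T U)
  let Y : Finset V := Finset.univ.filter (Poor G H T U)
  have hX : ∀ v, v ∈ X ↔ Rich G H T U v := by simp [X]
  have hY : ∀ v, v ∈ Y ↔ Poor G H T U v := by simp [Y]
  have hTpos := Finset.card_pos.2 hT
  have hcover : ∀ v, v ∉ T → v ∉ X → v ∉ H → v ∈ Y := fun v h1 h2 h3 =>
    (hY v).2 ⟨⟨h3, h1⟩, fun h => h2 ((hX v).2 h)⟩
  have hTX : T.card + X.card = (T ∪ X).card := (Finset.card_union_of_disjoint
    (Finset.disjoint_left.2 fun v hv hvX => ((hX v).1 hvX).1.2 hv)).symm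
  have hXH : Disjoint (T ∪ X) H := Finset.disjoint_union_left.2
    ⟨hTH, Finset.disjoint_left.2 fun v hv => ((hX v).1 hv).1.1⟩
  have hfirst : t * (1 + T.card) ≤ T.card + X.card := by
    obtain ⟨κ, hκ⟩ := C.free_poor.exists_label
    have hUκ : (U.image κ).card = T.card := by
      rw [← C.card_U, Finset.card_image_of_injOn]
      intro u hu v hv huv
      by_contra hne
      exact C.not_near_U hu hv hne ((hκ u (C.poor_of_mem_U hu) v (C.poor_of_mem_U hv)).1 huv)
    have := C.tough_bound htough hH (W := T ∪ X) Finset.subset_union_left hXH κ ?_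
      (by linarith) (Z := U) ?_ ?_ (by omega)
    · rw [hUκ, ← hTX] at this
      exact_mod_cast this
    · intro u hu huH v hv hvH huv
      rw [Finset.mem_union, not_or] at hu hv
      exact (hκ u ((hY u).1 (hcover u hu.1 hu.2 huH)) v
        ((hY v).1 (hcover v hv.1 hv.2 hvH))).2 (Or.inr (Or.inl huv))
    · exact Finset.disjoint_left.2 fun u hu hu' => (Finset.mem_union.1 hu').elim
        (C.poor_of_mem_U hu).1.2 fun h => (C.poor_of_mem_U hu).2 ((hX u).1 h)
    · exact Finset.disjoint_left.2 fun u hu => (C.poor_of_mem_U hu).1.1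
  obtain ⟨D, S⟩ := C.exists_isSegmentation hT
  choose! f hf using fun d hd => S.exists_short C (d := d) hd
  let F := IsSegmentation.shortSet T D f
  have hFY : F ⊆ Y := by
    intro v hv
    obtain ⟨d, hd, -, hvd⟩ := IsSegmentation.mem_shortSet.1 hv
    exact (hY v).2 (S.poor d hd v ((hf d hd).2.2.1 v hvd))
  have hFcard : F.card ≤ 6 * T.card := S.card_shortSet_le C fun d hd => (hf d hd).2.1
  obtain ⟨P, W, φ, h1, h2, h3, h4, -, h6, h7⟩ :=
    P4FreeOn.hasPathCover (G := G) (Y \ F) (C.free_poor.mono fun v hv =>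
      (hY v).1 (Finset.mem_sdiff.1 (Finset.mem_coe.1 hv)).1)
  have hfree := S.countP_isFree_le C hf h1 h2 fun v => by
    rw [h3, Finset.mem_sdiff, hY]
  have hnot := S.countP_not_isFree_le C
  have hlen : D.length = D.countP (IsSegmentation.isFree T) + D.countP (fun d => !IsSegmentation.isFree T d) := by
    rw [List.length_eq_countP_add_countP (IsSegmentation.isFree T)]
    simp
  have hTXD := S.card_add_card_le C fun v hv => (hX v).1 hv
  have hXT : T.card < X.card := by
    have : (T.card : ℝ) < X.card := by nlinarith
    exact_mod_cast this
  have hFW : ∀ v ∈ F ∪ W, v ∈ Y := fun v hv => (Finset.mem_union.1 hv).elim (fun h => hFY h)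
    fun h => (Finset.mem_sdiff.1 (h4 h)).1
  have hYH : Disjoint Y H := Finset.disjoint_left.2 fun v hv => ((hY v).1 hv).1.1
  have hZW : Disjoint ((Y \ F) \ W) ((T ∪ X) ∪ (F ∪ W)) := by
    refine Finset.disjoint_left.2 fun v hv hv' => ?_
    have hvY := (hY v).1 (Finset.mem_sdiff.1 (Finset.mem_sdiff.1 hv).1).1
    simp only [Finset.mem_sdiff, Finset.mem_union, hX] at hv hv'
    rcases hv' with (h | h) | h | h
    · exact hvY.1.2 h
    · exact hvY.2 h
    · exact hv.1.2 h
    · exact hv.2 h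
  have hφ : ∀ u ∉ (T ∪ X) ∪ (F ∪ W), u ∉ H → ∀ v ∉ (T ∪ X) ∪ (F ∪ W), v ∉ H → G.Adj u v →
      φ u = φ v := by
    intro u hu huH v hv hvH huv
    simp only [Finset.mem_union, not_or] at hu hv
    exact h6 u (Finset.mem_sdiff.2 ⟨hcover u hu.1.1 hu.1.2 huH, hu.2.1⟩) hu.2.2 v
      (Finset.mem_sdiff.2 ⟨hcover v hv.1.1 hv.1.2 hvH, hv.2.1⟩) hv.2.2 huv
  have hsecond := C.tough_bound htough hH
    (Finset.subset_union_left.trans Finset.subset_union_left)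
    (Finset.disjoint_union_left.2 ⟨hXH, Finset.disjoint_left.2 fun v hv =>
      Finset.disjoint_left.1 hYH (hFW v hv)⟩) φ hφ (by linarith) hZW
    (hYH.mono_left (Finset.sdiff_subset.trans Finset.sdiff_subset)) (by omega)
  have hcard : (((T ∪ X) ∪ (F ∪ W)).card : ℝ) ≤ 7 * T.card + X.card + W.card := by
    have h8 := Finset.card_union_le (T ∪ X) (F ∪ W)
    have h9 := Finset.card_union_le F W
    exact_mod_cast (by omega : ((T ∪ X) ∪ (F ∪ W)).card ≤ 7 * T.card + X.card + W.card)
  have hk : (W.card + X.card : ℝ) ≤ T.card + (((Y \ F) \ W).image φ).card := by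
    exact_mod_cast (by omega : W.card + X.card ≤ T.card + (((Y \ F) \ W).image φ).card)
  have hT0 : (1 : ℝ) ≤ T.card := by exact_mod_cast hTpos
  have hW0 : (0 : ℝ) ≤ W.card := by positivity
  generalize (T.card : ℝ) = τ at *
  generalize (X.card : ℝ) = ξ at *
  generalize (W.card : ℝ) = ω at *
  generalize ((((Y \ F) \ W).image φ).card : ℝ) = k at *
  have e1 : t * (ω + ξ) ≤ t * (τ + k) := mul_le_mul_of_nonneg_left hk (by linarith)
  have e2 : (t - 1) * (t + (t - 1) * τ) ≤ (t - 1) * (ω + ξ) :=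
    mul_le_mul_of_nonneg_left (by linarith) (by linarith)
  have e3 : 0 < (t ^ 2 - 3 * t - 6) * τ := mul_pos (by nlinarith) (by linarith)
  nlinarith

end CycleComponent

/-- A cyclic list through all vertices of a graph with at least three vertices is a Hamiltonian
cycle. -/
lemma IsCycleList.exists_isHamiltonianCycle {V : Type*} [Fintype V] [DecidableEq V]
    {G : SimpleGraph V} {l : List V} (hl : IsCycleList G.Adj l) (hnd : l.Nodup)
    (hmem : ∀ v, v ∈ l) (hn : 3 ≤ Fintype.card V) :
    ∃ a, ∃ p : G.Walk a a, p.IsHamiltonianCycle := by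
  obtain ⟨a, b, h, hba⟩ := hl
  have hne := h.ne_nil
  obtain rfl : l.head hne = a := by simpa [List.head?_eq_some_head hne] using h.2.1
  obtain rfl : l.getLast hne = b := by simpa [List.getLast?_eq_some_getLast hne] using h.2.2
  have hlen : l.length = Fintype.card V := by
    rw [← List.toFinset_card_of_nodup hnd, ← Finset.card_univ]
    exact congrArg _ (Finset.eq_univ_of_forall fun v => List.mem_toFinset.2 (hmem v))
  let p := Walk.ofSupport l hne h.1
  have hp : p.IsPath := by
    rw [Walk.isPath_def, Walk.support_ofSupport]
    exact hnd
  have hpl : p.length = l.length - 1 := Walk.length_ofSupport hne h.1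
  refine ⟨_, Walk.cons hba p, Walk.isHamiltonianCycle_iff_isCycle_and_length_eq.2
    ⟨(Walk.cons_isCycle_iff p hba).2 ⟨hp, fun hmem => ?_⟩, ?_⟩⟩
  · have h1 := hp.eq_snd_of_mem_edges (Sym2.eq_swap ▸ hmem)
    have h2 : p.getVert 1 = p.getVert p.length := by rw [Walk.getVert_length]; exact h1.symm
    have h3 := hp.getVert_injOn (by simp; omega) (by simp) h2
    omega
  · rw [Walk.length_cons]
    omega

/-- Every vertex outside a list lies in a component outside that list. -/
lemma exists_component {V : Type*} [Fintype V] [DecidableEq V] (G : SimpleGraph V) {l : List V}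
    {h₀ : V} (h : h₀ ∉ l) :
    ∃ H : Finset V, h₀ ∈ H ∧ (∀ v ∈ H, v ∉ l) ∧ (∀ v ∈ H, ∀ w ∉ l, G.Adj v w → w ∈ H) ∧
      ∀ a ∈ H, ∀ b ∈ H, ∃ η : List V, η.Nodup ∧ (∀ x ∈ η, x ∈ H) ∧ IsPathList G.Adj a η b := by
  classical
  let K : SimpleGraph V :=
    { Adj := fun v w => G.Adj v w ∧ v ∉ l ∧ w ∉ l
      symm := ⟨fun v w h => ⟨h.1.symm, h.2.2, h.2.1⟩⟩
      loopless := ⟨fun v h => h.1.ne rfl⟩ }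
  have hK : ∀ v, K.Reachable h₀ v → v ∉ l := by
    intro v hv
    obtain ⟨p⟩ := hv.symm
    cases p with
    | nil => exact h
    | cons hvw _ => exact hvw.2.1
  refine ⟨Finset.univ.filter (K.Reachable h₀), by simp, by simpa using hK, ?_, ?_⟩
  · intro v hv w hw hvw
    simp only [Finset.mem_filter, Finset.mem_univ, true_and] at hv ⊢
    exact hv.trans (Adj.reachable (G := K) ⟨hvw, hK v hv, hw⟩)
  · intro a ha b hb
    simp only [Finset.mem_filter, Finset.mem_univ, true_and] at ha hb ⊢
    obtain ⟨p, hp⟩ := (ha.symm.trans hb).exists_isPath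
    refine ⟨p.support, hp.support_nodup, fun x hx => ha.trans ⟨p.takeUntil x hx⟩,
      p.isChain_adj_support.imp fun _ _ h => h.1, ?_, ?_⟩
    · rw [List.head?_eq_some_head p.support_ne_nil, p.head_support]
    · rw [List.getLast?_eq_some_getLast p.support_ne_nil, p.getLast_support]

/-- Consecutive members of a cyclic list are related by its cyclic permutation. -/
lemma IsCycleList.formPerm {V : Type*} [DecidableEq V] {r : V → V → Prop} {l : List V}
    (hl : IsCycleList r l) (hnd : l.Nodup) :
    IsCycleList (fun a b => r a b ∧ l.formPerm a = b) l := by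
  obtain ⟨a, b, h, hba⟩ := hl
  refine ⟨a, b, ⟨?_, h.2⟩, hba, ?_⟩
  · exact List.isChain_iff_getElem.2 fun i hi =>
      ⟨h.1.getElem i hi, List.formPerm_apply_lt_getElem l hnd i hi⟩
  · cases l with
    | nil => exact absurd rfl h.ne_nil
    | cons x xs =>
      obtain ⟨-, h2, h3⟩ := h
      rw [List.getLast?_eq_some_getLast (List.cons_ne_nil x xs)] at h3
      simp only [List.head?_cons, Option.some.injEq] at h2 h3
      rw [← h3, ← h2, List.formPerm_apply_getLast]

/-- A longest cycle and a component outside it. -/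
lemma exists_cycleComponent {V : Type*} [Fintype V] [DecidableEq V] {G : SimpleGraph V}
    (hfree : P4P1Free G) {l : List V} (hnd : l.Nodup) (hl : IsCycleList G.Adj l)
    (hmax : ∀ m : List V, m.Nodup → IsCycleList G.Adj m → m.length ≤ l.length)
    {h₀ : V} (h : h₀ ∉ l) :
    ∃ H T U : Finset V, h₀ ∈ H ∧ Disjoint T H ∧ CycleComponent G l H T U := by
  classical
  obtain ⟨H, h0, hHl, hHadj, hHpath⟩ := exists_component G h
  let T : Finset V := Finset.univ.filter fun v => v ∉ H ∧ ∃ w ∈ H, G.Adj v w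
  have hT : ∀ v, v ∈ T ↔ v ∉ H ∧ ∃ w ∈ H, G.Adj v w := by simp [T]
  have hTl : ∀ v ∈ T, v ∈ l := by
    intro v hv
    obtain ⟨hvH, w, hw, hvw⟩ := (hT v).1 hv
    by_contra hvl
    exact hvH (hHadj w hw v hvl hvw.symm)
  have hadj : ∀ v, v ∉ H → v ∉ T → ∀ w ∈ H, ¬ G.Adj v w := fun v hvH hvT w hw hvw =>
    hvT ((hT v).2 ⟨hvH, w, hw, hvw⟩)
  refine ⟨H, T, T.image l.formPerm, h0, Finset.disjoint_left.2 fun v hv => ((hT v).1 hv).1, ?_⟩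
  exact
    { nodup := hnd
      cycle := (hl.formPerm hnd).mono fun a b hab => ⟨hab.1, fun hb => by
        obtain ⟨c, hc, hcb⟩ := Finset.mem_image.1 hb
        rwa [← l.formPerm.injective (hcb.trans hab.2.symm)]⟩
      longest := hmax
      notMem := fun v hv hvH => hHl v hvH hv
      mem_of_mem_T := hTl
      mem_of_mem_U := fun v hv => by
        obtain ⟨c, hc, rfl⟩ := Finset.mem_image.1 hv
        exact List.formPerm_apply_mem_of_mem (hTl c hc)
      card_U := Finset.card_image_of_injective _ l.formPerm.injective
      detour := fun s hs r hr => by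
        obtain ⟨-, a, ha, hsa⟩ := (hT s).1 hs
        obtain ⟨-, b, hb, hrb⟩ := (hT r).1 hr
        obtain ⟨η, h1, h2, h3⟩ := hHpath a ha b hb
        exact ⟨η, a, b, h1, h2, h3, hsa, hrb.symm⟩
      not_adj := hadj
      free := P4FreeOn.of_p4P1Free hfree (w := h₀) fun v hv => hadj v hv.1 hv.2 h₀ h0 }

/-- A labelling with at least two values of a tough graph is not constant along all edges. -/
lemma Tough.exists_adj {V α : Type*} [Fintype V] {G : SimpleGraph V} {t : ℝ} (ht : 0 < t)
    (htough : Tough t G) (φ : V → α) {a b : V} (hab : φ a ≠ φ b) :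
    ∃ u v, G.Adj u v ∧ φ u ≠ φ v := by
  classical
  by_contra! hφ
  have h1 := card_image_compl_le_ncomps ∅ φ fun u _ v _ => hφ u v
  have h2 : 1 < ((∅ : Finset V)ᶜ.image φ).card :=
    Finset.one_lt_card.2 ⟨φ a, by simp, φ b, by simp, hab⟩
  have h3 := htough _ (h2.trans_le h1)
  have h4 := mul_pos ht (Nat.cast_pos.2 (zero_lt_one.trans (h2.trans_le h1)))
  rw [Set.ncard_coe_finset, Finset.card_empty, Nat.cast_zero] at h3
  exact h3.not_gt h4

/-- A graph with an edge has a longest cyclic list, where edges count as cycles. -/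
lemma exists_longest_isCycleList {V : Type*} [Fintype V] {G : SimpleGraph V} {u v : V}
    (huv : G.Adj u v) : ∃ l : List V, l.Nodup ∧ IsCycleList G.Adj l ∧
      ∀ m : List V, m.Nodup → IsCycleList G.Adj m → m.length ≤ l.length := by
  classical
  let p : ℕ → Prop := fun k => ∃ l : List V, l.Nodup ∧ IsCycleList G.Adj l ∧ l.length = k
  have h2 : p 2 := ⟨[u, v], by simpa using huv.ne,
    ⟨u, v, IsPathList.singleton.cons huv, huv.symm⟩, rfl⟩
  have hle : ∀ m : List V, m.Nodup → m.length ≤ Fintype.card V := fun m hm =>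
    hm.length_le_card
  obtain ⟨l, hl, hlc, hlen⟩ :=
    Nat.findGreatest_spec (P := p) (hle [u, v] (by simpa using huv.ne)) h2
  exact ⟨l, hl, hlc, fun m hm hmc => hlen ▸ Nat.le_findGreatest (hle m hm) ⟨m, hm, hmc, rfl⟩⟩

theorem stmt15 {V : Type*} [Fintype V] [DecidableEq V] (G : SimpleGraph V) (t : ℝ) (ht : 4.5 ≤ t)
    (htough : Tough t G) (hfree : P4P1Free G) (hn : 3 ≤ Fintype.card V)
    (S : Set V) (hS : IsCutset G S)
    (c : (G.induce Sᶜ).ConnectedComponent) (A : Set V)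
    (hA : A = {v : V | ∃ h : v ∈ Sᶜ, (G.induce Sᶜ).connectedComponentMk ⟨v, h⟩ = c})
    (hbig : 2 * (Fintype.card V : ℝ) / (t + 1) ≤ (A.ncard : ℝ))
    (hrest : 2 * (Fintype.card V : ℝ) / (t + 1) ≤ ((Sᶜ \ A).ncard : ℝ)) :
    ∃ a, ∃ p : G.Walk a a, p.IsHamiltonianCycle := by
  have : Nontrivial V := Fintype.one_lt_card_iff_nontrivial.1 (by omega)
  obtain ⟨a, b, hab⟩ := exists_pair_ne V
  obtain ⟨u, v, huv, -⟩ := htough.exists_adj (by linarith) id hab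
  obtain ⟨l, hnd, hl, hmax⟩ := exists_longest_isCycleList huv
  by_cases hmem : ∀ v, v ∈ l
  · exact hl.exists_isHamiltonianCycle hnd hmem hn
  push Not at hmem
  obtain ⟨h₀, hh₀⟩ := hmem
  obtain ⟨H, T, U, h0, hTH, C⟩ := exists_cycleComponent hfree hnd hl hmax hh₀
  refine (C.false_of_tough ht htough ⟨h₀, h0⟩ hTH ?_).elim
  obtain ⟨x, hx⟩ := List.exists_mem_of_ne_nil l hl.choose_spec.choose_spec.1.ne_nil
  obtain ⟨y, z, hyz, hne⟩ := htough.exists_adj (by linarith) (fun w => w ∈ H) (a := h₀) (b := x)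
    (by simp [h0, C.notMem x hx])
  by_contra hT
  rw [Finset.not_nonempty_iff_eq_empty] at hT
  by_cases hy : y ∈ H <;> by_cases hz : z ∈ H
  · simp [hy, hz] at hne
  · exact C.not_adj z hz (by simp [hT]) y hy hyz.symm
  · exact C.not_adj y hy (by simp [hT]) z hz hyz
  · simp [hy, hz] at hne
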